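/- arXiv:1704.05896 — 3 statements merged into one kernel-verified Lean document; each statement's English description precedes it below -/
import Mathlib

section
/- The multiset ⟨a_1, ..., a_{3k}⟩ can be partitioned into k triples each summing to s if and only if the instance (T, 6k−1, 4k) has a solution, i.e., there exist exactly 6k−1 edges of T whose removal yields connected components that can be assigned to 4k groups with every group receiving exactly s vertices in total. -/
namespace TP

/-- Rooted binary trees. -/
inductive RBT : Type where
  | nil : RBT
  | node : RBT → RBT → RBT

/-- The number of vertices of a rooted binary tree. -/
def RBT.size : RBT → ℕ
  | .nil => 0
  | .node l r => l.size + r.size + 1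

/-- A nice binary tree: it has at most one vertex, or its left and right subtrees are
nice binary trees whose numbers of vertices differ by at most 1. -/
def RBT.IsNice : RBT → Prop
  | .nil => True
  | .node l r => l.IsNice ∧ r.IsNice ∧ Nat.dist l.size r.size ≤ 1

/-- Valid positions (vertices) of a rooted binary tree, encoded as lists of booleans:
`false` means "go to the left child", `true` means "go to the right child". -/
def RBT.Valid : RBT → List Bool → Prop
  | .nil, _ => False
  | .node _ _, [] => True
  | .node l _, (false :: bs) => RBT.Valid l bs
  | .node _ r, (true :: bs) => RBT.Valid r bs

/-- The vertex type of the tree `T` built from the path `H = (p_1, …, p_{3k})` (the `Sum.inl`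
part) together with, for each `i`, the binary tree `T_i` with shape `Tsh i` (the `Sum.inr` part,
vertices of `T_i` being its valid positions). -/
abbrev Vtx (k : ℕ) (Tsh : Fin (3*k) → RBT) : Type :=
  Fin (3*k) ⊕ (Σ i : Fin (3*k), {l : List Bool // (Tsh i).Valid l})

/-- The tree `T`: the path `p_1 — p_2 — ⋯ — p_{3k}`, an edge between `p_i` and the root `[]`
of `T_i` for each `i`, and the parent-child edges inside each binary tree `T_i`. -/
def TGraph (k : ℕ) (Tsh : Fin (3*k) → RBT) : SimpleGraph (Vtx k Tsh) :=
  SimpleGraph.fromRel (fun v w =>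
    match v, w with
    | Sum.inl i, Sum.inl j => (i : ℕ) + 1 = (j : ℕ)
    | Sum.inl i, Sum.inr ⟨j, x⟩ => i = j ∧ x.1 = []
    | Sum.inr ⟨i, x⟩, Sum.inr ⟨j, y⟩ => i = j ∧ ∃ c : Bool, y.1 = x.1 ++ [c]
    | _, _ => False)

/-- Combine the shapes of the left subtrees `L_i` and right subtrees `R_i` into
the shapes of the trees `T_i`. -/
def nodes {ι : Type} (L R : ι → RBT) : ι → RBT := fun i => RBT.node (L i) (R i)

/-- The vertex set of the subtree `T_i`. -/
def TiSet (k : ℕ) (Tsh : Fin (3*k) → RBT) (i : Fin (3*k)) : Set (Vtx k Tsh) :=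
  {v | ∃ x : {l : List Bool // (Tsh i).Valid l}, v = Sum.inr ⟨i, x⟩}

/-- The vertex set of the left subtree `L_i` of `T_i` (positions starting with `false`). -/
def LiSet (k : ℕ) (Tsh : Fin (3*k) → RBT) (i : Fin (3*k)) : Set (Vtx k Tsh) :=
  {v | ∃ x : {l : List Bool // (Tsh i).Valid l}, x.1.head? = some false ∧ v = Sum.inr ⟨i, x⟩}

/-- The vertex set of the right subtree `R_i` of `T_i` (positions starting with `true`). -/
def RiSet (k : ℕ) (Tsh : Fin (3*k) → RBT) (i : Fin (3*k)) : Set (Vtx k Tsh) :=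
  {v | ∃ x : {l : List Bool // (Tsh i).Valid l}, x.1.head? = some true ∧ v = Sum.inr ⟨i, x⟩}

/-- A solution `P = (E_P, λ_P)` cutting exactly `kk` edges: `E_P` is a set of exactly `kk`
edges of `G`, and `lam` assigns the connected components of `G − E_P` to `b` groups
(it is constant on each component), so that group `g` receives exactly `sizes g` vertices. -/
def IsSolutionEq {V : Type} (G : SimpleGraph V) (EP : Set (Sym2 V)) (kk b : ℕ)
    (sizes : Fin b → ℕ) (lam : V → Fin b) : Prop :=
  EP ⊆ G.edgeSet ∧ EP.ncard = kk ∧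
    (∀ v w : V, (G.deleteEdges EP).Reachable v w → lam v = lam w) ∧
    ∀ g : Fin b, {v | lam v = g}.ncard = sizes g

/-- `C` is a `P`-component: a connected component of `G − E_P`. -/
def IsPComp {V : Type} (G : SimpleGraph V) (EP : Set (Sym2 V)) (C : Set V) : Prop :=
  ∃ v : V, C = {w | (G.deleteEdges EP).Reachable v w}

end TP

open TP


namespace TPX
open TP

def pos : RBT → Finset (List Bool)
  | .nil => ∅
  | .node l r => insert [] ((pos l).image (List.cons false) ∪ (pos r).image (List.cons true))

lemma mem_pos (t : RBT) (x : List Bool) : x ∈ pos t ↔ t.Valid x := by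
  induction t generalizing x with
  | nil => simp [pos, RBT.Valid]
  | node l r ihl ihr =>
    rcases x with _ | ⟨b, bs⟩
    · simp [pos, RBT.Valid]
    · cases b <;> simp [pos, RBT.Valid, ihl, ihr]

def sub : RBT → List Bool → RBT
  | t, [] => t
  | .nil, _ :: _ => .nil
  | .node l _, (false :: bs) => sub l bs
  | .node _ r, (true :: bs) => sub r bs

lemma card_pos (t : RBT) : (pos t).card = t.size := by
  induction t with
  | nil => rfl
  | node l r ihl ihr =>
    have h1 : Function.Injective (List.cons false) := List.cons_injective
    have h2 : Function.Injective (List.cons true) := List.cons_injective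
    rw [pos, Finset.card_insert_of_notMem (by simp), Finset.card_union_of_disjoint,
      Finset.card_image_of_injective _ h1, Finset.card_image_of_injective _ h2, ihl, ihr, RBT.size]
    rw [Finset.disjoint_left]
    simp only [Finset.mem_image]
    rintro _ ⟨a, _, rfl⟩ ⟨b, _, hb⟩
    simp at hb

lemma sub_nil (x : List Bool) : sub .nil x = .nil := by cases x <;> rfl

lemma card_sub (t : RBT) (x : List Bool) :
    ((pos t).filter (fun y => x <+: y)).card = (sub t x).size := by
  induction x generalizing t with
  | nil => simp [sub, card_pos]
  | cons b bs ih =>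
    cases t with
    | nil => simp [pos, sub, RBT.size]
    | node l r =>
      cases b
      · rw [sub, ← ih l, ← Finset.card_image_of_injective ((pos l).filter (fun y => bs <+: y)) (List.cons_injective (a := false))]
        congr 1
        ext y
        rcases y with _ | ⟨c, cs⟩
        · simp
        · cases c <;> simp [pos, List.cons_prefix_cons]
      · rw [sub, ← ih r, ← Finset.card_image_of_injective ((pos r).filter (fun y => bs <+: y)) (List.cons_injective (a := true))]
        congr 1
        ext y
        rcases y with _ | ⟨c, cs⟩
        · simp
        · cases c <;> simp [pos, List.cons_prefix_cons]

lemma sub_size_le (t : RBT) (x : List Bool) : (sub t x).size ≤ t.size := by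
  induction x generalizing t with
  | nil => simp [sub]
  | cons b bs ih =>
    cases t with
    | nil => simp [sub]
    | node l r =>
      cases b
      · have := ih l
        simp only [sub, RBT.size]; omega
      · have := ih r
        simp only [sub, RBT.size]; omega

lemma nice_children {l r : RBT} (h : (RBT.node l r).IsNice) :
    l.IsNice ∧ r.IsNice ∧ l.size ≤ r.size + 1 ∧ r.size ≤ l.size + 1 := by
  obtain ⟨h1, h2, h3⟩ := h
  refine ⟨h1, h2, ?_⟩
  unfold Nat.dist at h3
  omega

/-- a proper subtree has at most half the size -/
lemma nice_sub (t : RBT) (h : t.IsNice) (b : Bool) :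
    (sub t [b]).IsNice ∧ (1 ≤ t.size → 2 * (sub t [b]).size ≤ t.size ∧
      t.size ≤ 2 * (sub t [b]).size + 2) := by
  cases t with
  | nil => simp [sub, RBT.size, RBT.IsNice]
  | node l r =>
    obtain ⟨h1, h2, h3, h4⟩ := nice_children h
    cases b <;> simp only [sub, RBT.size]
    · exact ⟨h1, fun _ => by omega⟩
    · exact ⟨h2, fun _ => by omega⟩

lemma sub_cons (t : RBT) (b : Bool) (bs : List Bool) : sub t (b :: bs) = sub (sub t [b]) bs := by
  cases t with
  | nil => simp [sub_nil]
  | node l r => cases b <;> simp [sub]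

lemma L_sizes (t : RBT) (h : t.IsNice) (x : List Bool) (a : ℕ) (ht : t.size = a) (ha : 1 ≤ a) :
    (sub t x).size = a ∨ 2 * (sub t x).size ≤ a := by
  rcases x with _ | ⟨b, bs⟩
  · left; simpa [sub] using ht
  · right
    have := (nice_sub t h b).2 (by omega)
    have h2 := sub_size_le (sub t [b]) bs
    rw [sub_cons]; omega

lemma R_sizes (t : RBT) (h : t.IsNice) (x : List Bool) (q : ℕ) (hq : 10 ≤ q)
    (ht : t.size = 4 * q - 2) :
    x = [] ∨ (sub t x).size = 2 * q - 1 ∨ (sub t x).size = 2 * q - 2 ∨ (sub t x).size = q - 1 ∨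
      (sub t x).size = q - 2 ∨ (sub t x).size ≤ q / 2 := by
  rcases x with _ | ⟨b, _ | ⟨c, _ | ⟨d, ds⟩⟩⟩
  · simp
  · have := (nice_sub t h b).2 (by omega)
    omega
  · rw [sub_cons]
    have h1 := (nice_sub t h b)
    have h2 := h1.2 (by omega)
    have := (nice_sub _ h1.1 c).2 (by omega)
    omega
  · rw [sub_cons, sub_cons, sub_cons]
    have h1 := (nice_sub t h b)
    have h2 := h1.2 (by omega)
    have h3 := (nice_sub _ h1.1 c)
    have h4 := h3.2 (by omega)
    have h5 := (nice_sub _ h3.1 d)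
    have h6 := h5.2 (by omega)
    have h7 := sub_size_le (sub (sub (sub t [b]) [c]) [d]) ds
    omega

def cell (t : RBT) (S : Finset (List Bool)) (z : List Bool) : Finset (List Bool) :=
  (pos t).filter (fun y => z <+: y ∧ ∀ x ∈ S, x <+: y → x <+: z)

def rest (t : RBT) (S : Finset (List Bool)) : Finset (List Bool) :=
  (pos t).filter (fun y => ∀ x ∈ S, ¬ x <+: y)

lemma prefix_antisymm {x y : List Bool} (h : x <+: y) (h' : y <+: x) : x = y :=
  h.eq_of_length (le_antisymm h.length_le h'.length_le)

lemma exists_top (S : Finset (List Bool)) (y x : List Bool) (hx : x ∈ S) (hxy : x <+: y) :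
    ∃ z ∈ S, z <+: y ∧ x <+: z ∧ ∀ u ∈ S, u <+: y → u <+: z := by
  obtain ⟨z, hz, hmax⟩ := Finset.exists_max_image (S.filter (fun u => u <+: y)) List.length
    ⟨x, by simp [hx, hxy]⟩
  rw [Finset.mem_filter] at hz
  have key : ∀ u ∈ S, u <+: y → u <+: z := fun u hu huy =>
    List.prefix_of_prefix_length_le huy hz.2 (hmax u (by simp [hu, huy]))
  exact ⟨z, hz.1, hz.2, key x hx hxy, key⟩

lemma cell_disj (t : RBT) (S : Finset (List Bool)) :
    (S : Set (List Bool)).PairwiseDisjoint (cell t S) := by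
  intro z hz z' hz' hne
  rw [Function.onFun, Finset.disjoint_left]
  intro y hy hy'
  simp only [cell, Finset.mem_filter] at hy hy'
  exact hne (prefix_antisymm (hy'.2.2 z hz hy.2.1) (hy.2.2 z' hz' hy'.2.1))

lemma sum_cells_le (t : RBT) (S : Finset (List Bool)) (x : List Bool) :
    ∑ z ∈ S.filter (fun z => x <+: z), (cell t S z).card ≤ (sub t x).size := by
  rw [← card_sub, ← Finset.card_biUnion]
  · apply Finset.card_le_card
    intro y
    simp only [Finset.mem_biUnion, Finset.mem_filter, cell]
    rintro ⟨z, ⟨_, h1⟩, h2, h3, _⟩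
    exact ⟨h2, h1.trans h3⟩
  · intro z hz z' hz' hne
    exact cell_disj t S (Finset.mem_filter.1 hz).1 (Finset.mem_filter.1 hz').1 hne

lemma sum_cells_eq (t : RBT) (S : Finset (List Bool)) (x : List Bool) (hx : x ∈ S) :
    ∑ z ∈ S.filter (fun z => x <+: z), (cell t S z).card = (sub t x).size := by
  apply le_antisymm (sum_cells_le t S x)
  rw [← card_sub, ← Finset.card_biUnion]
  · apply Finset.card_le_card
    intro y
    simp only [Finset.mem_biUnion, Finset.mem_filter, cell]
    rintro ⟨h1, h2⟩
    obtain ⟨z, hz, h3, h4, h5⟩ := exists_top S y x hx h2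
    exact ⟨z, ⟨hz, h4⟩, h1, h3, h5⟩
  · intro z hz z' hz' hne
    exact cell_disj t S (Finset.mem_filter.1 hz).1 (Finset.mem_filter.1 hz').1 hne

/-- counting a predicate that is constant on cells -/
lemma count_pred (t : RBT) (S : Finset (List Bool)) (P : List Bool → Prop) [DecidablePred P]
    (P0 : Prop) [Decidable P0]
    (h1 : ∀ z ∈ S, ∀ y ∈ cell t S z, (P y ↔ P z)) (h2 : ∀ y ∈ rest t S, (P y ↔ P0)) :
    ((pos t).filter P).card = (∑ z ∈ S, if P z then (cell t S z).card else 0) +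
      if P0 then (rest t S).card else 0 := by
  have e1 : (pos t) = S.biUnion (cell t S) ∪ rest t S := by
    ext y
    simp only [Finset.mem_union, Finset.mem_biUnion, cell, rest, Finset.mem_filter]
    constructor
    · intro hy
      by_cases h : ∃ x ∈ S, x <+: y
      · obtain ⟨x, hx, hxy⟩ := h
        obtain ⟨z, hz, h3, h4, h5⟩ := exists_top S y x hx hxy
        exact Or.inl ⟨z, hz, hy, h3, h5⟩
      · push Not at h
        exact Or.inr ⟨hy, h⟩
    · rintro (⟨z, _, h, _⟩ | ⟨h, _⟩) <;> exact h
  have e2 : Disjoint (S.biUnion (cell t S)) (rest t S) := by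
    rw [Finset.disjoint_left]
    intro y
    simp only [Finset.mem_biUnion, cell, rest, Finset.mem_filter]
    rintro ⟨z, hz, _, h, _⟩ ⟨_, h'⟩
    exact h' z hz h
  rw [e1, Finset.filter_union, Finset.card_union_of_disjoint
    (Finset.disjoint_filter_filter e2), Finset.filter_biUnion, Finset.card_biUnion]
  · congr 1
    · apply Finset.sum_congr rfl
      intro z hz
      split_ifs with h
      · congr 1
        apply Finset.filter_true_of_mem
        intro y hy
        exact (h1 z hz y hy).2 h
      · rw [Finset.card_eq_zero]
        apply Finset.filter_false_of_mem
        intro y hy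
        exact fun h' => h ((h1 z hz y hy).1 h')
    · split_ifs with h
      · congr 1
        apply Finset.filter_true_of_mem
        intro y hy
        exact (h2 y hy).2 h
      · rw [Finset.card_eq_zero]
        apply Finset.filter_false_of_mem
        intro y hy
        exact fun h' => h ((h2 y hy).1 h')
  · intro z hz z' hz' hne
    exact Finset.disjoint_filter_filter (cell_disj t S hz hz' hne)

lemma total_cells (t : RBT) (S : Finset (List Bool)) :
    ∑ z ∈ S, (cell t S z).card + (rest t S).card = t.size := by
  have := count_pred t S (fun _ => True) True (by simp) (by simp)
  simpa [card_pos] using this.symm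

lemma cell_pos (t : RBT) (S : Finset (List Bool)) (z : List Bool) (hz : z ∈ pos t) :
    1 ≤ (cell t S z).card := by
  rw [Nat.one_le_iff_ne_zero, Finset.card_ne_zero]
  exact ⟨z, by simp [cell, hz]⟩

lemma rest_of_root (t : RBT) (S : Finset (List Bool)) (h : [] ∈ S) : (rest t S).card = 0 := by
  rw [Finset.card_eq_zero, rest]
  apply Finset.filter_false_of_mem
  intro y _ h'
  exact h' [] h List.nil_prefix


def wt (q x : ℕ) : ℕ :=
  if x ≤ q / 2 + 2 then 1 else if 4 * q < x + (q / 2 + 3) ∧ x < 4 * q then 5 else 3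

lemma wt_cases (q x : ℕ) : (wt q x = 1 ∧ x ≤ q / 2 + 2) ∨
    (wt q x = 3 ∧ q / 2 + 2 < x ∧ ¬ (4 * q < x + (q / 2 + 3) ∧ x < 4 * q)) ∨
    (wt q x = 5 ∧ q / 2 + 2 < x ∧ 4 * q < x + (q / 2 + 3) ∧ x < 4 * q) := by
  unfold wt
  split_ifs <;> omega

/-- Bookkeeping of a finite family of component sizes. -/
lemma wt_stats {α : Type} [DecidableEq α] (q : ℕ) (A : Finset α) (c : α → ℕ) :
    ∃ n1 n3 n5 d1 d3 d5 : ℕ,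
      A.card = n1 + n3 + n5 ∧ ∑ z ∈ A, wt q (c z) = n1 + 3 * n3 + 5 * n5 ∧
      ∑ z ∈ A, c z = d1 + d3 + d5 ∧ d1 ≤ n1 * (q / 2 + 2) ∧
      (∀ M, (∀ z ∈ A, c z ≤ M) → d3 ≤ n3 * M ∧ d5 ≤ n5 * M) ∧
      (∀ _u : Unit, (∀ z ∈ A, wt q (c z) = 1 → c z = 2) → d1 = n1 * 2) ∧
      (∀ _u : Unit, n3 = 0 → ∀ z ∈ A, wt q (c z) ≠ 3) ∧ (∀ _u : Unit, n5 = 0 → ∀ z ∈ A, wt q (c z) ≠ 5) ∧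
      (∀ _u : Unit, n3 = 1 → ∃ z ∈ A, wt q (c z) = 3 ∧ c z = d3 ∧ ∀ z' ∈ A, wt q (c z') = 3 → z' = z) ∧
      (n3 = 0 → d3 = 0) ∧ (n5 = 0 → d5 = 0) ∧ (n1 = 0 → d1 = 0) ∧
      (∀ _u : Unit, (∀ z ∈ A, wt q (c z) ≠ 5) → n5 = 0) := by
  have split : ∀ f : α → ℕ, ∑ z ∈ A, f z = ∑ z ∈ A.filter (fun z => wt q (c z) = 1), f z +
      ∑ z ∈ A.filter (fun z => wt q (c z) = 3), f z +
      ∑ z ∈ A.filter (fun z => wt q (c z) = 5), f z := by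
    intro f
    rw [Finset.sum_filter, Finset.sum_filter, Finset.sum_filter, ← Finset.sum_add_distrib,
      ← Finset.sum_add_distrib]
    apply Finset.sum_congr rfl
    intro z _
    rcases wt_cases q (c z) with h | h | h <;> simp [h.1]
  refine ⟨(A.filter (fun z => wt q (c z) = 1)).card, (A.filter (fun z => wt q (c z) = 3)).card,
    (A.filter (fun z => wt q (c z) = 5)).card, ∑ z ∈ A.filter (fun z => wt q (c z) = 1), c z,
    ∑ z ∈ A.filter (fun z => wt q (c z) = 3), c z, ∑ z ∈ A.filter (fun z => wt q (c z) = 5), c z,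
    ?_, ?_, split _, ?_, ?_, ?_, ?_, ?_, ?_, ?_, ?_, ?_, ?_⟩
  · simpa using split (fun _ => 1)
  · rw [split (fun z => wt q (c z))]
    congr 1
    congr 1
    · rw [Finset.sum_congr rfl (g := fun _ => 1)]
      · simp
      · intro z hz; exact (Finset.mem_filter.1 hz).2
    · rw [Finset.sum_congr rfl (g := fun _ => 3)]
      · simp [mul_comm]
      · intro z hz; exact (Finset.mem_filter.1 hz).2
    · rw [Finset.sum_congr rfl (g := fun _ => 5)]
      · simp [mul_comm]
      · intro z hz; exact (Finset.mem_filter.1 hz).2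
  · apply Finset.sum_le_card_nsmul
    intro z hz
    have := (Finset.mem_filter.1 hz).2
    rcases wt_cases q (c z) with h | h | h <;> omega
  · intro M hM
    constructor <;>
    · apply Finset.sum_le_card_nsmul
      intro z hz
      exact hM z (Finset.mem_filter.1 hz).1
  · intro _ h
    rw [Finset.sum_congr rfl (g := fun _ => 2)]
    · simp
    · intro z hz; exact h z (Finset.mem_filter.1 hz).1 (Finset.mem_filter.1 hz).2
  · intro _ h z hz h'
    rw [Finset.card_eq_zero] at h
    have : z ∈ A.filter (fun z => wt q (c z) = 3) := by simp [hz, h']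
    simp [h] at this
  · intro _ h z hz h'
    rw [Finset.card_eq_zero] at h
    have : z ∈ A.filter (fun z => wt q (c z) = 5) := by simp [hz, h']
    simp [h] at this
  · intro _ h
    obtain ⟨z, hz⟩ := Finset.card_eq_one.1 h
    have hz' : z ∈ A.filter (fun z => wt q (c z) = 3) := by simp [hz]
    refine ⟨z, (Finset.mem_filter.1 hz').1, (Finset.mem_filter.1 hz').2, by simp [hz], ?_⟩
    intro z' h1 h2
    have : z' ∈ A.filter (fun z => wt q (c z) = 3) := by simp [h1, h2]
    simpa [hz] using this
  · intro h; rw [Finset.card_eq_zero] at h; simp [h]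
  · intro h; rw [Finset.card_eq_zero] at h; simp [h]
  · intro h; rw [Finset.card_eq_zero] at h; simp [h]
  · intro _ h
    rw [Finset.card_eq_zero]
    exact Finset.filter_false_of_mem h

/-- group inequality -/
lemma group_le {α : Type} [DecidableEq α] (q : ℕ) (A : Finset α) (c : α → ℕ)
    (hc : ∑ z ∈ A, c z = 4 * q) :
    ∑ z ∈ A, wt q (c z) ≤ 3 * A.card ∧ (∑ z ∈ A, wt q (c z) = 3 * A.card →
      (∀ x ∈ A, wt q (c x) = 1 → ∃ y ∈ A, wt q (c y) = 5 ∧ c x + c y = 4 * q) ∧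
      (∀ x ∈ A, wt q (c x) = 5 → ∃ y ∈ A, wt q (c y) = 1) ∧
      (∀ x ∈ A, wt q (c x) = 3 → 3 * q < c x → c x < 4 * q →
        ∃ y ∈ A, wt q (c y) = 3 ∧ c y < q)) := by
  by_cases h5 : ∃ x ∈ A, wt q (c x) = 5
  · obtain ⟨x, hx, hx5⟩ := h5
    have e1 := Finset.add_sum_erase A c hx
    have e2 := Finset.add_sum_erase A (fun z => wt q (c z)) hx
    have hsm : ∀ y ∈ A.erase x, wt q (c y) = 1 := by
      intro y hy
      have := Finset.single_le_sum (f := c) (fun i _ => Nat.zero_le _) hy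
      have h1 := wt_cases q (c y)
      have h2 := wt_cases q (c x)
      omega
    rw [Finset.sum_congr rfl hsm] at e2
    simp only [Finset.sum_const, smul_eq_mul, mul_one] at e2
    have h2 := wt_cases q (c x)
    have hne : (A.erase x).Nonempty := by
      by_contra h
      rw [Finset.not_nonempty_iff_eq_empty] at h
      rw [h] at e1
      simp at e1
      omega
    have hcard := Finset.card_erase_add_one hx
    have hp := Finset.card_pos.2 hne
    refine ⟨by omega, fun heq => ?_⟩
    have h1 : (A.erase x).card = 1 := by omega
    obtain ⟨y, hy⟩ := Finset.card_eq_one.1 h1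
    have hyA : y ∈ A := Finset.mem_of_mem_erase (a := x) (by simp [hy])
    have hy1 := hsm y (by simp [hy])
    have hall : ∀ z ∈ A, z = x ∨ z = y := by
      intro z hz
      by_cases h : z = x
      · exact Or.inl h
      · right
        have : z ∈ A.erase x := by simp [h, hz]
        simpa [hy] using this
    rw [hy] at e1
    simp only [Finset.sum_singleton] at e1
    refine ⟨?_, ?_, ?_⟩
    · intro z hz hz1
      rcases hall z hz with rfl | rfl
      · omega
      · exact ⟨x, hx, hx5, by omega⟩
    · intro z hz _
      exact ⟨y, hyA, hy1⟩
    · intro z hz hz3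
      rcases hall z hz with rfl | rfl <;> omega
  · push Not at h5
    have hle : ∀ z ∈ A, wt q (c z) ≤ 3 := by
      intro z hz
      have := h5 z hz
      have := wt_cases q (c z)
      omega
    have hs : ∑ z ∈ A, wt q (c z) ≤ 3 * A.card := by
      have := Finset.sum_le_card_nsmul A (fun z => wt q (c z)) 3 hle
      simpa [mul_comm] using this
    refine ⟨hs, fun heq => ?_⟩
    have hall : ∀ z ∈ A, wt q (c z) = 3 := by
      have : ∑ z ∈ A, wt q (c z) = ∑ z ∈ A, 3 := by simp [heq, mul_comm]
      exact (Finset.sum_eq_sum_iff_of_le hle).1 this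
    refine ⟨?_, ?_, ?_⟩
    · intro z hz hz1
      have := hall z hz
      omega
    · intro z hz hz1
      have := hall z hz
      omega
    · intro x hx _ h1 h2
      have e1 := Finset.add_sum_erase A c hx
      have hne : (A.erase x).Nonempty := by
        by_contra h
        rw [Finset.not_nonempty_iff_eq_empty] at h
        rw [h] at e1
        simp at e1
        omega
      obtain ⟨y, hy⟩ := hne
      have := Finset.single_le_sum (f := c) (fun i _ => Nat.zero_le _) hy
      exact ⟨y, Finset.mem_of_mem_erase hy, hall y (Finset.mem_of_mem_erase hy), by omega⟩

set_option maxHeartbeats 4000000 in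
/-- The local lemma. -/
lemma local_lemma (q a : ℕ) (L R : RBT) (hL : L.IsNice) (hR : R.IsNice) (hLs : L.size = a)
    (hRs : R.size = 4 * q - 2) (ha1 : q + 6 ≤ a) (ha2 : a + 18 ≤ 2 * q)
    (S : Finset (List Bool)) (hS : S ⊆ pos (.node L R)) (c : List Bool → ℕ)
    (hcdef : ∀ z, c z = (cell (.node L R) S z).card)
    (hc : ∀ z ∈ S, c z ≤ 4 * q) (rem : ℕ) (hrem : rem = (rest (.node L R) S).card + 1)
    (hrem2 : rem ≤ 4 * q) (g : ℕ) (hg : g = (rem - 1) / q) :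
    6 ≤ ∑ z ∈ S, wt q (c z) + g ∧ (∑ z ∈ S, wt q (c z) + g = 6 →
      (∀ z ∈ S, wt q (c z) = 3 → q ≤ c z) ∧ (∀ z ∈ S, wt q (c z) = 5 → c z = 4 * q - 2) ∧
      ((∀ z ∈ S, wt q (c z) = 1 → c z = 2) →
        (∀ z ∈ S, wt q (c z) = 3 → c z ≤ 3 * q ∨ c z = 4 * q) →
        ∃ x, S = {x} ∧ (wt q (c x) = 5 ∨ wt q (c x) = 3))) := by
  have htot := total_cells (.node L R) S
  simp only [← hcdef, RBT.size, hLs, hRs] at htot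
  have hsub := sum_cells_le (.node L R) S
  have hsubeq := sum_cells_eq (.node L R) S
  simp only [← hcdef] at hsub hsubeq
  have gl : ∀ m, m * q < rem → m ≤ g := by
    intro m hm
    rw [hg, Nat.le_div_iff_mul_le (by omega)]
    omega
  have gu : ∀ m, g = m → rem ≤ (m + 1) * q := by
    intro m hm
    have : (rem - 1) / q < m + 1 := by omega
    rw [Nat.div_lt_iff_lt_mul (by omega)] at this
    omega
  -- sizes of all subtrees
  have hsz : ∀ y, y ≠ [] → y ≠ [true] → (sub (.node L R) y).size ≤ 2 * q - 1 ∧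
      (([true] <+: y) → (sub (.node L R) y).size = 2 * q - 1 ∨ (sub (.node L R) y).size = 2 * q - 2 ∨
        (sub (.node L R) y).size = q - 1 ∨ (sub (.node L R) y).size = q - 2 ∨
        (sub (.node L R) y).size ≤ q / 2) ∧
      (¬ ([true] <+: y) → (sub (.node L R) y).size = a ∨ 2 * (sub (.node L R) y).size ≤ a) := by
    intro y h1 h2
    rcases y with _ | ⟨b, bs⟩
    · exact absurd rfl h1
    · cases b
      · have := L_sizes L hL bs a hLs (by omega)
        simp only [sub, List.cons_prefix_cons]
        refine ⟨by omega, by simp, fun _ => this⟩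
      · have hne : bs ≠ [] := fun h => h2 (by rw [h])
        have := (R_sizes R hR bs q (by omega) hRs).resolve_left hne
        simp only [sub, List.cons_prefix_cons, List.nil_prefix]
        refine ⟨by omega, fun _ => by tauto, by simp⟩
  have hcsub : ∀ z ∈ S, c z ≤ (sub (.node L R) z).size := by
    intro z hz
    refine le_trans ?_ (hsub z)
    exact Finset.single_le_sum (f := c) (fun i _ => Nat.zero_le _) (by simp [hz])
  by_cases hroot : [] ∈ S
  · -- the root edge is cut
    have hr0 := rest_of_root (.node L R) S hroot
    have hr1 : rem = 1 := by omega
    have hg0 : g = 0 := by rw [hg, hr1]; simp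
    obtain ⟨n1, n3, n5, d1, d3, d5, e1, e2, e3, e4, e5, e6, e7, e8, e9, e10, e11, e12, e13'⟩ :=
      wt_stats q S c
    obtain ⟨e5a, e5b⟩ := e5 _ hc
    have hge : 6 ≤ ∑ z ∈ S, wt q (c z) := by
      by_contra hlt
      have : n1 ≤ 5 := by omega
      have : n3 ≤ 1 := by omega
      have : n5 ≤ 1 := by omega
      interval_cases n1 <;> interval_cases n3 <;> interval_cases n5 <;> omega
    refine ⟨by omega, fun heq => ?_⟩
    have hW : n1 + 3 * n3 + 5 * n5 = 6 := by omega
    have h5 : n5 = 0 := by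
      by_contra h
      have : n5 = 1 := by omega
      have : n1 = 1 := by omega
      have : n3 = 0 := by omega
      subst n5 n1 n3
      omega
    subst h5
    have h5' := e8 () rfl
    have hcases : (n3 = 2 ∧ n1 = 0) ∨ (n3 = 1 ∧ n1 = 3) := by
      have : n3 ≤ 2 := by omega
      interval_cases n3
      · have : n1 = 6 := by omega
        subst n1
        omega
      · right; omega
      · left; omega
    refine ⟨?_, ?_, ?_⟩
    · intro z hz hz3
      rcases hcases with ⟨rfl, rfl⟩ | ⟨rfl, rfl⟩
      · have e13 := Finset.add_sum_erase S c hz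
        have hle : ∑ y ∈ S.erase z, c y ≤ (S.erase z).card • (4 * q) := Finset.sum_le_card_nsmul (S.erase z) c (4 * q)
          (fun y hy => hc y (Finset.mem_of_mem_erase hy))
        rw [Finset.card_erase_of_mem hz, e1] at hle
        simp at hle
        omega
      · obtain ⟨z0, _, _, h3, h4⟩ := e9 () rfl
        have := h4 z hz hz3
        subst this
        omega
    · intro z hz hz5
      exact absurd hz5 (h5' z hz)
    · intro hsm hbig
      exfalso
      have hd1 := e6 () hsm
      rcases hcases with ⟨rfl, rfl⟩ | ⟨rfl, rfl⟩
      · -- S = {[], y}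
        have hcard : (S.erase []).card = 1 := by
          rw [Finset.card_erase_of_mem hroot, e1]
        obtain ⟨y, hy⟩ := Finset.card_eq_one.1 hcard
        have hyS : y ∈ S.erase [] := by simp [hy]
        have hne := Finset.ne_of_mem_erase hyS
        have hyS := Finset.mem_of_mem_erase hyS
        have hSeq : S = {[], y} := by rw [← Finset.insert_erase hroot, hy]
        have hfil : S.filter (fun z => y <+: z) = {y} := by
          rw [hSeq]
          ext z
          simp only [Finset.mem_filter, Finset.mem_insert, Finset.mem_singleton]
          constructor
          · rintro ⟨rfl | rfl, h⟩
            · exact absurd (List.prefix_nil.1 h) hne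
            · rfl
          · rintro rfl; simp
        have hcy := hsubeq y hyS
        rw [hfil, Finset.sum_singleton] at hcy
        have e13 := Finset.add_sum_erase S c hroot
        rw [hy, Finset.sum_singleton] at e13
        have hw : ∀ z ∈ S, wt q (c z) = 3 := by
          intro z hz
          by_contra h
          have h1 : ∀ z ∈ S, wt q (c z) ≤ 3 := by
            intro z hz
            have := h5' z hz
            have := wt_cases q (c z)
            omega
          have h2 := Finset.sum_lt_sum h1 ⟨z, hz, lt_of_le_of_ne (h1 z hz) h⟩
          simp [e1] at h2
          omega
        have hwy := hw y hyS
        have hb1 := hbig y hyS hwy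
        have hb2 := hbig [] hroot (hw _ hroot)
        have hcr := hc [] hroot
        have hyt : y ≠ [true] := by
          rintro rfl
          simp only [sub, hRs] at hcy
          have := wt_cases q (c [true])
          omega
        have hz := hsz y hne hyt
        by_cases hp : [true] <+: y
        · have := hz.2.1 hp
          omega
        · have := hz.2.2 hp
          have := wt_cases q (c [])
          have := hw _ hroot
          omega
      · omega
  · -- root edge not cut
    set SR := S.filter (fun z => [true] <+: z) with hSR
    set SL := S.filter (fun z => ¬ [true] <+: z) with hSL
    have hsplit : ∀ f : List Bool → ℕ, ∑ z ∈ SR, f z + ∑ z ∈ SL, f z = ∑ z ∈ S, f z :=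
      fun f => Finset.sum_filter_add_sum_filter_not S _ f
    have hDL : ∑ z ∈ SL, c z ≤ a := by
      have h := hsub [false]
      simp only [sub, hLs] at h
      have : S.filter (fun z => [false] <+: z) = SL := by
        apply Finset.filter_congr
        intro z hz
        rcases z with _ | ⟨b, bs⟩
        · exact absurd hz hroot
        · cases b <;> simp [List.cons_prefix_cons]
      rw [this] at h
      exact h
    have hDR : ∑ z ∈ SR, c z ≤ 4 * q - 2 := by
      have h := hsub [true]
      simp only [sub, hRs] at h
      exact h
    have hcL : ∀ z ∈ SL, c z ≤ 2 * q - 1 := by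
      intro z hz
      have hz' := Finset.mem_filter.1 hz
      refine le_trans (hcsub z hz'.1) (hsz z ?_ ?_).1
      · rintro rfl; exact hroot hz'.1
      · rintro rfl; exact hz'.2 (List.prefix_refl _)
    have hDs := hsplit c
    have hWs := hsplit (fun z => wt q (c z))
    by_cases ht : [true] ∈ S
    · have hDR' : ∑ z ∈ SR, c z = 4 * q - 2 := by
        have h := hsubeq [true] ht
        simp only [sub, hRs] at h
        exact h
      have htR : [true] ∈ SR := by simp [hSR, ht]
      obtain ⟨n1, n3, n5, d1, d3, d5, e1, e2, e3, e4, e5, e6, e7, e8, e9, e10, e11, e12, e13'⟩ :=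
        wt_stats q SR c
      have hcR : ∀ z ∈ SR, c z ≤ 4 * q := fun z hz => hc z (Finset.mem_filter.1 hz).1
      -- weight of the right part
      have hWR : 5 ≤ ∑ z ∈ SR, wt q (c z) ∧ (∑ z ∈ SR, wt q (c z) = 5 →
          (SR = {[true]} ∧ c [true] = 4 * q - 2 ∧ wt q (c [true]) = 5) ∨
            (n1 = 2 ∧ n3 = 1 ∧ n5 = 0)) := by
        have hcp := Finset.card_pos.2 ⟨_, htR⟩
        rcases Nat.lt_or_ge SR.card 3 with hlt | hge
        · rcases (by omega : SR.card = 1 ∨ SR.card = 2) with h1 | h2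
          · obtain ⟨y, hy⟩ := Finset.card_eq_one.1 h1
            have : y = [true] := by rw [hy] at htR; exact (Finset.mem_singleton.1 htR).symm
            subst this
            rw [hy] at hDR' ⊢
            simp only [Finset.sum_singleton] at hDR' ⊢
            have := wt_cases q (c [true])
            refine ⟨by omega, fun _ => Or.inl ⟨by trivial, by omega, by omega⟩⟩
          · have hcard : (SR.erase [true]).card = 1 := by
              rw [Finset.card_erase_of_mem htR, h2]
            obtain ⟨y, hy⟩ := Finset.card_eq_one.1 hcard
            have hyS : y ∈ SR.erase [true] := by simp [hy]
            have hne := Finset.ne_of_mem_erase hyS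
            have hyS := Finset.mem_of_mem_erase hyS
            have hSeq : SR = {[true], y} := by rw [← Finset.insert_erase htR, hy]
            have hyS' := Finset.mem_filter.1 hyS
            have hfil : S.filter (fun z => y <+: z) = {y} := by
              ext z
              simp only [Finset.mem_filter, Finset.mem_singleton]
              constructor
              · rintro ⟨hz, h⟩
                have : z ∈ SR := Finset.mem_filter.2 ⟨hz, hyS'.2.trans h⟩
                rw [hSeq] at this
                simp only [Finset.mem_insert, Finset.mem_singleton] at this
                rcases this with rfl | rfl
                · exact absurd (prefix_antisymm h hyS'.2) hne
                · rfl
              · rintro rfl; exact ⟨hyS'.1, List.prefix_refl _⟩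
            have hcy := hsubeq y hyS'.1
            rw [hfil, Finset.sum_singleton] at hcy
            have hy0 : y ≠ [] := by rintro rfl; exact hroot hyS'.1
            have hz := (hsz y hy0 hne).2.1 hyS'.2
            have e13 := Finset.add_sum_erase SR c htR
            have e14 := Finset.add_sum_erase SR (fun z => wt q (c z)) htR
            rw [hy, Finset.sum_singleton] at e13 e14
            have w1 := wt_cases q (c y)
            have w2 := wt_cases q (c [true])
            have : 6 ≤ ∑ z ∈ SR, wt q (c z) := by omega
            exact ⟨by omega, by omega⟩
        · have hM := e5 _ hcR
          have : ¬ (∑ z ∈ SR, wt q (c z) ≤ 5 ∧ ¬ (n1 = 2 ∧ n3 = 1 ∧ n5 = 0)) := by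
            rintro ⟨h1, h2⟩
            have h5 : n5 = 0 := by omega
            have h3 : n3 = 0 := by omega
            have : n1 ≤ 5 := by omega
            have := Nat.mul_le_mul_right (q / 2 + 2) this
            have := e10 h3
            have := e11 h5
            omega
          constructor <;> omega
      obtain ⟨hWR5, hWReq⟩ := hWR
      by_cases hLe : SL = ∅
      · rw [hLe] at hDs hWs hDL
        simp only [Finset.sum_empty, add_zero] at hDs hWs hDL
        have hr : rem = a + 2 := by omega
        have hg1 : 1 ≤ g := gl 1 (by omega)
        refine ⟨by omega, fun heq => ?_⟩
        have hSS : SR = S := by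
          rw [← Finset.filter_union_filter_not_eq (fun z => [true] <+: z) S, ← hSR, ← hSL, hLe]
          simp
        rcases hWReq (by omega) with ⟨h1, h2, h3⟩ | ⟨rfl, rfl, rfl⟩
        · rw [hSS] at h1
          refine ⟨?_, ?_, fun _ _ => ⟨_, h1, Or.inl h3⟩⟩
          · intro z hz
            rw [h1, Finset.mem_singleton] at hz
            subst hz
            omega
          · intro z hz
            rw [h1, Finset.mem_singleton] at hz
            subst hz
            omega
        · obtain ⟨z0, hz0, h2, h3, h4⟩ := e9 () rfl
          have h5 := e11 rfl
          rw [hSS] at h4 hz0 e6 e8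
          refine ⟨?_, ?_, ?_⟩
          · intro z hz hz3
            rw [h4 z hz hz3]
            omega
          · intro z hz hz5
            exact absurd hz5 (e8 () rfl z hz)
          · intro hsm hbig
            exfalso
            have := e6 () hsm
            have := wt_cases q (c z0)
            omega
      · -- left part nonempty
        have hWL : 1 ≤ ∑ z ∈ SL, wt q (c z) := by
          obtain ⟨y, hy⟩ := Finset.nonempty_iff_ne_empty.2 hLe
          have := Finset.single_le_sum (f := fun z => wt q (c z)) (fun i _ => Nat.zero_le _) hy
          have := wt_cases q (c y)
          omega
        refine ⟨by omega, fun heq => ?_⟩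
        have hWL1 : ∑ z ∈ SL, wt q (c z) = 1 := by omega
        have hgz : g = 0 := by omega
        have hrq := gu 0 hgz
        have hLcard : SL.card = 1 := by
          have h1 : SL.card ≤ ∑ z ∈ SL, wt q (c z) := by
            have := Finset.card_nsmul_le_sum SL (fun z => wt q (c z)) 1
              (fun z _ => by have := wt_cases q (c z); omega)
            simpa using this
          have := Finset.card_pos.2 (Finset.nonempty_iff_ne_empty.2 hLe)
          omega
        obtain ⟨y, hy⟩ := Finset.card_eq_one.1 hLcard
        rw [hy, Finset.sum_singleton] at hWL1
        have hyL : y ∈ SL := by simp [hy]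
        have hyS := (Finset.mem_filter.1 hyL).1
        rw [hy, Finset.sum_singleton] at hDs
        have hmem : ∀ z ∈ S, z ∈ SR ∨ z = y := by
          intro z hz
          by_cases h : [true] <+: z
          · left; exact Finset.mem_filter.2 ⟨hz, h⟩
          · right
            have : z ∈ SL := Finset.mem_filter.2 ⟨hz, h⟩
            simpa [hy] using this
        rcases hWReq (by omega) with ⟨h1, h2, h3⟩ | ⟨rfl, rfl, rfl⟩
        · refine ⟨?_, ?_, ?_⟩
          · intro z hz h
            rcases hmem z hz with h' | rfl
            · rw [h1, Finset.mem_singleton] at h'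
              subst h'
              omega
            · omega
          · intro z hz h
            rcases hmem z hz with h' | rfl
            · rw [h1, Finset.mem_singleton] at h'
              subst h'
              omega
            · omega
          · intro hsm _
            exfalso
            have := hsm y hyS hWL1
            omega
        · obtain ⟨z0, hz0, h2, h3, h4⟩ := e9 () rfl
          have h5 := e11 rfl
          refine ⟨?_, ?_, ?_⟩
          · intro z hz hz3
            rcases hmem z hz with h' | rfl
            · rw [h4 z h' hz3]
              omega
            · omega
          · intro z hz hz5
            rcases hmem z hz with h' | rfl
            · exact absurd hz5 (e8 () rfl z h')
            · omega
          · intro hsm hbig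
            exfalso
            have := e6 () (fun z hz => hsm z (Finset.mem_filter.1 hz).1)
            have := wt_cases q (c z0)
            omega
    · -- neither
      have hcS : ∀ z ∈ S, c z ≤ 2 * q - 1 := by
        intro z hz
        refine le_trans (hcsub z hz) (hsz z ?_ ?_).1
        · rintro rfl; exact hroot hz
        · rintro rfl; exact ht hz
      obtain ⟨n1, n3, n5, d1, d3, d5, e1, e2, e3, e4, e5, e6, e7, e8, e9, e10, e11, e12, e13'⟩ :=
        wt_stats q S c
      obtain ⟨e5a, e5b⟩ := e5 _ hcS
      have hno5 : ∀ z ∈ S, wt q (c z) ≠ 5 := by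
        intro z hz h
        have := hcS z hz
        have := wt_cases q (c z)
        omega
      have g1 := gl 1
      have g2 := gl 2
      have g3 := gl 3
      have u2 := gu 2
      have u3 := gu 3
      have hno : n5 = 0 := e13' () hno5
      subst hno
      have hd5 := e11 rfl
      have hge : 6 ≤ ∑ z ∈ S, wt q (c z) + g ∧ (∑ z ∈ S, wt q (c z) + g = 6 →
          (n1 = 0 ∧ n3 = 1) ∨ (n1 = 1 ∧ n3 = 1 ∧ g = 2) ∨ (n1 ≤ 4 ∧ n3 = 0)) := by
        by_cases hle : ∑ z ∈ S, wt q (c z) ≤ 6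
        · have : n1 ≤ 6 := by omega
          have : n3 ≤ 2 := by omega
          interval_cases n3 <;> interval_cases n1 <;> omega
        · omega
      refine ⟨hge.1, fun heq => ?_⟩
      have hcs := hge.2 heq
      refine ⟨?_, fun z hz h => absurd h (hno5 z hz), ?_⟩
      · intro z hz hz3
        rcases hcs with ⟨rfl, rfl⟩ | ⟨rfl, rfl, rfl⟩ | ⟨h, rfl⟩
        · obtain ⟨z0, _, _, h3, h4⟩ := e9 () rfl
          rw [h4 z hz hz3]
          omega
        · obtain ⟨z0, _, _, h3, h4⟩ := e9 () rfl
          rw [h4 z hz hz3]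
          omega
        · exact absurd hz3 (e7 () rfl z hz)
      · intro hsm _
        have hd1 := e6 () hsm
        rcases hcs with ⟨rfl, rfl⟩ | ⟨rfl, rfl, rfl⟩ | ⟨h, rfl⟩
        · obtain ⟨y, hy⟩ := Finset.card_eq_one.1 e1
          obtain ⟨z0, h1, h2, _⟩ := e9 () rfl
          rw [hy, Finset.mem_singleton] at h1
          subst h1
          exact ⟨_, hy, Or.inr h2⟩
        · omega
        · have := e10 rfl
          omega

section bridge

variable {k : ℕ} {T : Fin (3*k) → RBT}

lemma valid_init (t : RBT) (x : List Bool) (c : Bool) (h : t.Valid (x ++ [c])) : t.Valid x := by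
  induction x generalizing t with
  | nil => cases t <;> simp_all [RBT.Valid]
  | cons b bs ih =>
    cases t with
    | nil => simp_all [RBT.Valid]
    | node l r => cases b <;> exact ih _ h

lemma valid_dropLast (t : RBT) (x : List Bool) (hx : x ≠ []) (h : t.Valid x) :
    t.Valid x.dropLast := by
  apply valid_init t x.dropLast (x.getLast hx)
  rwa [List.dropLast_append_getLast]

def par : Vtx k T → Vtx k T
  | Sum.inl i => Sum.inl ⟨i.1 - 1, by omega⟩
  | Sum.inr ⟨i, x⟩ => if h : x.1 = [] then Sum.inl i else
      Sum.inr ⟨i, x.1.dropLast, valid_dropLast _ _ h x.2⟩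

def dep : Vtx k T → ℕ
  | Sum.inl i => i.1
  | Sum.inr ⟨i, x⟩ => i.1 + 1 + x.1.length

lemma dep_par (v : Vtx k T) : par v = v ∨ dep (par v) + 1 = dep v := by
  rcases v with i | ⟨i, x, hx⟩
  · by_cases h : i.1 = 0
    · left
      simp only [par]
      congr 1
      ext
      simp [h]
    · right
      simp only [par, dep]
      omega
  · right
    by_cases h : x = []
    · simp [par, dep, h]
    · have : 0 < x.length := List.length_pos_iff.2 h
      simp [par, dep, h]
      omega

lemma adj_iff (v w : Vtx k T) : (TGraph k T).Adj v w ↔ v ≠ w ∧ (v = par w ∨ w = par v) := by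
  have key : ∀ v w : Vtx k T, v ≠ w → ((match v, w with
    | Sum.inl i, Sum.inl j => (i : ℕ) + 1 = (j : ℕ)
    | Sum.inl i, Sum.inr ⟨j, x⟩ => i = j ∧ x.1 = []
    | Sum.inr ⟨i, x⟩, Sum.inr ⟨j, y⟩ => i = j ∧ ∃ c : Bool, y.1 = x.1 ++ [c]
    | _, _ => False) ↔ v = par w) := by
    rintro (i | ⟨i, x, hx⟩) (j | ⟨j, y, hy⟩) hne
    · simp only [par, Sum.inl.injEq, Fin.ext_iff]
      have : i.1 ≠ j.1 := fun h => hne (by rw [Fin.ext h])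
      omega
    · by_cases h : y = [] <;> simp [par, h]
    · simp [par]
    · by_cases h : y = []
      · simp [par, h]
      · simp only [par, h, dite_false, Sum.inr.injEq]
        constructor
        · rintro ⟨rfl, c, hc⟩
          subst hc
          simp
        · intro e
          rw [Sigma.mk.injEq] at e
          obtain ⟨rfl, e⟩ := e
          rw [heq_eq_eq, Subtype.mk.injEq] at e
          refine ⟨rfl, y.getLast h, ?_⟩
          simp only [e]
          exact (List.dropLast_append_getLast h).symm
  unfold TGraph
  rw [SimpleGraph.fromRel_adj]
  constructor
  · rintro ⟨h, h1⟩
    refine ⟨h, ?_⟩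
    rcases h1 with h1 | h1
    · exact Or.inl ((key _ _ h).1 h1)
    · exact Or.inr ((key _ _ h.symm).1 h1)
  · rintro ⟨h, h1⟩
    refine ⟨h, ?_⟩
    rcases h1 with h1 | h1
    · exact Or.inl ((key _ _ h).2 h1)
    · exact Or.inr ((key _ _ h.symm).2 h1)

lemma edge_inj : Set.InjOn (fun v : Vtx k T => s(v, par v)) {v | par v ≠ v} := by
  intro v hv w hw h
  simp only [Sym2.eq_iff] at h
  rcases h with h | ⟨h1, h2⟩
  · exact h.1
  · exfalso
    have a1 := (dep_par v).resolve_left hv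
    have a2 := (dep_par w).resolve_left hw
    rw [h2] at a1
    rw [← h1] at a2
    omega

def Mid (k : ℕ) (T : Fin (3*k) → RBT) (K b s : ℕ) : Prop :=
  ∃ (C : Set (Vtx k T)) (lam : Vtx k T → Fin b), (∀ v ∈ C, par v ≠ v) ∧ C.ncard = K ∧
    (∀ v, v ∉ C → lam v = lam (par v)) ∧ ∀ g, {v | lam v = g}.ncard = s

lemma mid_iff (K b s : ℕ) : (∃ (EP : Set (Sym2 (Vtx k T))) (lam : Vtx k T → Fin b),
    IsSolutionEq (TGraph k T) EP K b (fun _ => s) lam) ↔ Mid k T K b s := by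
  constructor
  · rintro ⟨EP, lam, h1, h2, h3, h4⟩
    refine ⟨{v | par v ≠ v ∧ s(v, par v) ∈ EP}, lam, fun v hv => hv.1, ?_, ?_, h4⟩
    · rw [← h2, ← Set.InjOn.ncard_image (edge_inj.mono (fun v hv => hv.1))]
      congr 1
      ext e
      constructor
      · rintro ⟨v, hv, rfl⟩
        exact hv.2
      · intro he
        have := h1 he
        induction e with
        | h v w =>
          rw [SimpleGraph.mem_edgeSet, adj_iff] at this
          obtain ⟨hne, h | h⟩ := this
          · subst h
            exact ⟨w, ⟨hne, by rwa [Sym2.eq_swap]⟩, Sym2.eq_swap⟩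
          · subst h
            exact ⟨v, ⟨hne.symm, he⟩, rfl⟩
    · intro v hv
      by_cases hp : par v = v
      · rw [hp]
      · apply h3
        apply SimpleGraph.Adj.reachable
        rw [SimpleGraph.deleteEdges_adj, adj_iff]
        exact ⟨⟨fun h => hp h.symm, Or.inr rfl⟩, fun h => hv ⟨hp, h⟩⟩
  · rintro ⟨C, lam, h1, h2, h3, h4⟩
    refine ⟨(fun v => s(v, par v)) '' C, lam, ?_, ?_, ?_, h4⟩
    · rintro e ⟨v, hv, rfl⟩
      rw [SimpleGraph.mem_edgeSet, adj_iff]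
      exact ⟨fun h => h1 v hv h.symm, Or.inr rfl⟩
    · rw [Set.InjOn.ncard_image (edge_inj.mono h1), h2]
    · rintro v w ⟨p⟩
      induction p with
      | nil => rfl
      | cons hadj _ ih =>
        rw [← ih]
        rw [SimpleGraph.deleteEdges_adj, adj_iff] at hadj
        obtain ⟨⟨hne, h | h⟩, hn⟩ := hadj
        · rw [h]
          symm
          apply h3
          intro hc
          apply hn
          exact ⟨_, hc, by rw [h, Sym2.eq_swap]⟩
        · rw [h]
          apply h3
          intro hc
          apply hn
          exact ⟨_, hc, by rw [h]⟩

lemma ncard_vtx (X : Set (Vtx k T)) (pP : Fin (3*k) → Prop) (pT : Fin (3*k) → List Bool → Prop)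
    [DecidablePred pP] [∀ i, DecidablePred (pT i)] (h1 : ∀ i, Sum.inl i ∈ X ↔ pP i)
    (h2 : ∀ i x h, Sum.inr ⟨i, x, h⟩ ∈ X ↔ pT i x) :
    X.ncard = (Finset.univ.filter pP).card + ∑ i, ((pos (T i)).filter (pT i)).card := by
  let φ : Vtx k T → Fin (3*k) ⊕ (Σ _ : Fin (3*k), List Bool) :=
    Sum.map id (fun y => ⟨y.1, y.2.1⟩)
  have hφ : Function.Injective φ := by
    apply Function.Injective.sumMap Function.injective_id
    rintro ⟨i, x, hx⟩ ⟨j, y, hy⟩ h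
    simp only [Sigma.mk.injEq, heq_eq_eq] at h
    obtain ⟨rfl, rfl⟩ := h
    rfl
  have : φ '' X = ((Finset.univ.filter pP).disjSum
      (Finset.univ.sigma fun i => (pos (T i)).filter (pT i)) : Finset _) := by
    ext e
    simp only [Set.mem_image, Finset.mem_coe, Finset.mem_disjSum, Finset.mem_filter,
      Finset.mem_univ, true_and, Finset.mem_sigma]
    constructor
    · rintro ⟨i | ⟨i, x, hx⟩, hv, rfl⟩
      · left; exact ⟨i, (h1 i).1 hv, rfl⟩
      · right; exact ⟨⟨i, x⟩, ⟨(mem_pos _ _).2 hx, (h2 i x hx).1 hv⟩, rfl⟩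
    · rintro (⟨i, hi, rfl⟩ | ⟨⟨i, x⟩, ⟨hx, hp⟩, rfl⟩)
      · exact ⟨Sum.inl i, (h1 i).2 hi, rfl⟩
      · exact ⟨Sum.inr ⟨i, x, (mem_pos _ _).1 hx⟩, (h2 i x _).2 hp, rfl⟩
  rw [← Set.ncard_image_of_injective X hφ, this, Set.ncard_coe_finset, Finset.card_disjSum,
    Finset.card_sigma]

def Comb (k : ℕ) (T : Fin (3*k) → RBT) (K b s : ℕ) : Prop :=
  ∃ (cP : Finset (Fin (3*k))) (S : Fin (3*k) → Finset (List Bool)) (lp : Fin (3*k) → Fin b)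
    (l : Fin (3*k) → List Bool → Fin b),
    (∀ i ∈ cP, i.1 ≠ 0) ∧ (∀ i, S i ⊆ pos (T i)) ∧ cP.card + ∑ i, (S i).card = K ∧
    (∀ i j : Fin (3*k), j.1 + 1 = i.1 → i ∉ cP → lp i = lp j) ∧
    (∀ i, [] ∈ pos (T i) → [] ∉ S i → l i [] = lp i) ∧
    (∀ i x c, x ++ [c] ∈ pos (T i) → x ++ [c] ∉ S i → l i (x ++ [c]) = l i x) ∧
    ∀ g, (Finset.univ.filter (fun i => lp i = g)).card +
      ∑ i, ((pos (T i)).filter (fun x => l i x = g)).card = s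

lemma par_inr (i : Fin (3*k)) (x : List Bool) (c : Bool) (h : (T i).Valid (x ++ [c])) :
    par (Sum.inr ⟨i, x ++ [c], h⟩ : Vtx k T) = Sum.inr ⟨i, x, valid_init _ _ _ h⟩ := by
  simp [par]

open Classical in
lemma comb_of_mid (K b s : ℕ) (h : Mid k T K b s) : Comb k T K b s := by
  obtain ⟨C, lam, h1, h2, h3, h4⟩ := h
  refine ⟨Finset.univ.filter (fun i => Sum.inl i ∈ C),
    fun i => (pos (T i)).filter (fun x => ∃ h, Sum.inr ⟨i, x, h⟩ ∈ C),
    fun i => lam (Sum.inl i),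
    fun i x => if h : (T i).Valid x then lam (Sum.inr ⟨i, x, h⟩) else lam (Sum.inl i),
    ?_, ?_, ?_, ?_, ?_, ?_, ?_⟩
  · intro i hi h0
    apply h1 _ (Finset.mem_filter.1 hi).2
    simp only [par]
    congr 1
    ext
    simp [h0]
  · intro i; exact Finset.filter_subset _ _
  · rw [← h2]
    symm
    apply ncard_vtx
    · intro i; rfl
    · intro i x h
      exact ⟨fun h' => ⟨h, h'⟩, fun ⟨_, h'⟩ => h'⟩
  · intro i j hij hi
    have : Sum.inl i ∉ C := by simpa using hi
    show lam (Sum.inl i) = lam (Sum.inl j)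
    rw [h3 _ this]
    simp only [par]
    congr 2
    ext
    simp only
    omega
  · intro i hi hn
    have hv := (mem_pos _ _).1 hi
    simp only [hv, dite_true]
    rw [h3]
    · simp [par]
    · intro hc
      exact hn (Finset.mem_filter.2 ⟨hi, hv, hc⟩)
  · intro i x c hi hn
    have hv := (mem_pos _ _).1 hi
    simp only [hv, valid_init _ _ _ hv, dite_true]
    rw [h3, par_inr]
    intro hc
    exact hn (Finset.mem_filter.2 ⟨hi, hv, hc⟩)
  · intro g
    rw [← h4 g]
    symm
    apply ncard_vtx
    · intro i; rfl
    · intro i x h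
      simp [h]

lemma mid_of_comb (K b s : ℕ) (h : Comb k T K b s) : Mid k T K b s := by
  obtain ⟨cP, S, lp, l, h1, h2, h3, h4, h5, h6, h7⟩ := h
  refine ⟨{v | Sum.elim (fun i => i ∈ cP) (fun y => y.2.1 ∈ S y.1) v},
    Sum.elim lp (fun y => l y.1 y.2.1), ?_, ?_, ?_, ?_⟩
  · rintro (i | ⟨i, x, hx⟩) hv hp
    · have := h1 i hv
      simp only [par, Sum.inl.injEq, Fin.ext_iff] at hp
      omega
    · have := dep_par (Sum.inr ⟨i, x, hx⟩ : Vtx k T)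
      by_cases h : x = []
      · simp [par, h] at hp
      · have h' := List.length_pos_iff.2 h
        simp only [par, h, dite_false, Sum.inr.injEq, Sigma.mk.injEq, heq_eq_eq, true_and,
          Subtype.mk.injEq] at hp
        have := congrArg List.length hp
        simp at this
        omega
  · rw [← h3, ncard_vtx _ (fun i => i ∈ cP) (fun i x => x ∈ S i) (fun i => Iff.rfl)
      (fun i x h => Iff.rfl)]
    congr 1
    · simp
    · apply Finset.sum_congr rfl
      intro i _
      congr 1
      ext x
      simp only [Finset.mem_filter]
      exact ⟨fun h => h.2, fun h => ⟨h2 i h, h⟩⟩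
  · rintro (i | ⟨i, x, hx⟩) hv
    · by_cases h0 : i.1 = 0
      · simp only [par, Sum.elim_inl]
        congr 1
        ext
        simp [h0]
      · simp only [par, Sum.elim_inl]
        exact h4 _ _ (by simp; omega) hv
    · rcases List.eq_nil_or_concat x with rfl | ⟨y, c, rfl⟩
      · simp only [par, dite_true, Sum.elim_inl, Sum.elim_inr]
        exact h5 i ((mem_pos _ _).2 hx) hv
      · simp only [List.concat_eq_append] at hx hv ⊢
        rw [par_inr]
        simp only [Sum.elim_inr]
        exact h6 i y c ((mem_pos _ _).2 hx) hv
  · intro g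
    rw [← h7 g]
    exact ncard_vtx _ _ _ (fun i => Iff.rfl) (fun i x h => Iff.rfl)

end bridge

lemma filter_left (l r : RBT) : ((pos (.node l r)).filter (fun x => x.head? = some false)).card = l.size := by
  have h := card_sub (.node l r) [false]
  simp only [sub] at h
  rw [← h]
  congr 1
  apply Finset.filter_congr
  intro x _
  rcases x with _ | ⟨b, bs⟩
  · simp
  · cases b <;> simp [List.cons_prefix_cons]

lemma filter_notleft (l r : RBT) :
    ((pos (.node l r)).filter (fun x => ¬ x.head? = some false)).card = r.size + 1 := by
  have h := Finset.card_filter_add_card_filter_not (s := pos (.node l r)) (fun x => x.head? = some false)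
  rw [filter_left, card_pos, RBT.size] at h
  omega

lemma forward (k s : ℕ) (hk : 1 ≤ k) (hs : 24 * k < s) (a : Fin (3*k) → ℕ)
    (L R : Fin (3*k) → RBT) (hL : ∀ i, (L i).size = a i) (hLp : ∀ i, 1 ≤ a i)
    (hR : ∀ i, (R i).size = s - 2) (g : Fin (3*k) → Fin k)
    (hg : ∀ j, ∑ i ∈ Finset.univ.filter (fun i => g i = j), a i = s) :
    Comb k (nodes L R) (6*k-1) (4*k) s := by
  refine ⟨Finset.univ.erase ⟨0, by omega⟩, fun _ => {[false]}, fun i => ⟨i.1, by omega⟩,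
    fun i x => if x.head? = some false then ⟨3*k + (g i).1, by omega⟩ else ⟨i.1, by omega⟩,
    ?_, ?_, ?_, ?_, ?_, ?_, ?_⟩
  · intro i hi h0
    exact (Finset.mem_erase.1 hi).1 (Fin.ext h0)
  · intro i
    rw [Finset.singleton_subset_iff]
    have h1 : 1 ≤ (L i).size := by rw [hL]; exact hLp i
    rw [mem_pos]
    simp only [nodes, RBT.Valid]
    cases h : L i with
    | nil => rw [h] at h1; simp [RBT.size] at h1
    | node l r => simp [RBT.Valid]
  · rw [Finset.card_erase_of_mem (Finset.mem_univ _)]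
    simp
    omega
  · intro i j hij hi
    exfalso
    apply hi
    simp only [Finset.mem_erase, Finset.mem_univ, and_true]
    intro h
    rw [Fin.ext_iff] at h
    simp only at h
    omega
  · intro i _ _
    simp
  · intro i x c _ hn
    rcases x with _ | ⟨b, bs⟩
    · cases c
      · simp at hn
      · simp
    · simp
  · intro gg
    by_cases hlt : gg.1 < 3 * k
    · have e1 : (Finset.univ.filter (fun i : Fin (3*k) => (⟨i.1, by omega⟩ : Fin (4*k)) = gg)) =
          {⟨gg.1, hlt⟩} := by
        ext i
        simp [Fin.ext_iff]
      rw [e1, Finset.sum_eq_single ⟨gg.1, hlt⟩]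
      · have e2 : (pos (nodes L R ⟨gg.1, hlt⟩)).filter (fun x => (if x.head? = some false then
            (⟨3*k + (g ⟨gg.1, hlt⟩).1, by omega⟩ : Fin (4*k)) else ⟨gg.1, by omega⟩) = gg) =
            (pos (nodes L R ⟨gg.1, hlt⟩)).filter (fun x => ¬ x.head? = some false) := by
          apply Finset.filter_congr
          intro x _
          by_cases h : x.head? = some false
          · simp only [h, if_true, Fin.ext_iff]
            constructor
            · intro; omega
            · simp
          · simp [h]
        rw [e2, nodes, filter_notleft, hR]
        simp
        omega
      · intro i _ hne
        rw [Finset.card_eq_zero]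
        apply Finset.filter_false_of_mem
        intro x _
        have hne' : i.1 ≠ gg.1 := fun h => hne (Fin.ext h)
        by_cases h : x.head? = some false
        · simp only [h, if_true, Fin.ext_iff]
          omega
        · simp only [h, if_false, Fin.ext_iff]
          exact hne'
      · simp
    · have hj : gg.1 - 3 * k < k := by omega
      have e1 : (Finset.univ.filter (fun i : Fin (3*k) => (⟨i.1, by omega⟩ : Fin (4*k)) = gg)) =
          ∅ := by
        apply Finset.filter_false_of_mem
        intro i _
        simp only [Fin.ext_iff]
        omega
      rw [e1, Finset.card_empty, zero_add, ← hg ⟨gg.1 - 3 * k, hj⟩, Finset.sum_filter]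
      apply Finset.sum_congr rfl
      intro i _
      by_cases hi : g i = ⟨gg.1 - 3 * k, hj⟩
      · rw [if_pos hi, ← hL i, ← filter_left (L i) (R i), nodes]
        congr 1
        apply Finset.filter_congr
        intro x _
        by_cases h : x.head? = some false
        · simp only [h, if_true, Fin.ext_iff, hi, iff_true]
          omega
        · simp only [h, if_false, Fin.ext_iff, iff_false]
          omega
      · rw [if_neg hi, Finset.card_eq_zero]
        apply Finset.filter_false_of_mem
        intro x _
        rw [Fin.ext_iff] at hi
        by_cases h : x.head? = some false
        · simp only [h, if_true, Fin.ext_iff]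
          simp only at hi
          omega
        · simp only [h, if_false, Fin.ext_iff]
          omega

lemma exists_tp {n : ℕ} {β : Type} (cP : Finset (Fin n)) (lp : Fin n → β)
    (h4 : ∀ i j : Fin n, j.1 + 1 = i.1 → i ∉ cP → lp i = lp j) :
    ∃ tp : Fin n → Fin n, ∀ i, ((tp i).1 = 0 ∨ tp i ∈ cP) ∧ lp (tp i) = lp i ∧
      ((i.1 = 0 ∨ i ∈ cP) → tp i = i) := by
  have key : ∀ m : ℕ, ∀ i : Fin n, i.1 = m → ∃ t : Fin n, (t.1 = 0 ∨ t ∈ cP) ∧ lp t = lp i ∧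
      ((i.1 = 0 ∨ i ∈ cP) → t = i) := by
    intro m
    induction m with
    | zero => intro i hi; exact ⟨i, Or.inl hi, rfl, fun _ => rfl⟩
    | succ m ih =>
      intro i hi
      by_cases hc : i ∈ cP
      · exact ⟨i, Or.inr hc, rfl, fun _ => rfl⟩
      · obtain ⟨t, h1, h2, _⟩ := ih ⟨m, by omega⟩ rfl
        refine ⟨t, h1, ?_, ?_⟩
        · rw [h2]; exact (h4 i ⟨m, by omega⟩ (by simp [hi]) hc).symm
        · rintro (h | h)
          · omega
          · exact absurd h hc
  choose tp htp using fun i => key _ i rfl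
  exact ⟨tp, htp⟩

lemma const_cell {β : Type} (t : RBT) (S : Finset (List Bool)) (l : List Bool → β)
    (h6 : ∀ x c, x ++ [c] ∈ pos t → x ++ [c] ∉ S → l (x ++ [c]) = l x)
    (z y : List Bool) (hy : y ∈ cell t S z) : l y = l z := by
  induction y using List.reverseRecOn with
  | nil =>
    simp only [cell, Finset.mem_filter, List.prefix_nil] at hy
    rw [hy.2.1]
  | append_singleton y c ih =>
    by_cases he : y ++ [c] = z
    · rw [he]
    · simp only [cell, Finset.mem_filter] at hy ih
      obtain ⟨h1, h2, h3⟩ := hy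
      have h2' : z <+: y := by
        rcases List.prefix_concat_iff.1 (by simpa using h2) with h | h
        · exact absurd h.symm (by simpa using he)
        · exact h
      rw [h6 y c h1]
      · apply ih
        refine ⟨(mem_pos _ _).2 (valid_init _ _ _ ((mem_pos _ _).1 h1)), h2', ?_⟩
        intro x hx hxy
        exact h3 x hx (hxy.trans (List.prefix_append _ _))
      · intro hS
        exact he (prefix_antisymm (h3 _ hS (List.prefix_refl _)) h2)

lemma const_rest {β : Type} (t : RBT) (S : Finset (List Bool)) (l : List Bool → β) (l0 : β)
    (h5 : [] ∈ pos t → [] ∉ S → l [] = l0)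
    (h6 : ∀ x c, x ++ [c] ∈ pos t → x ++ [c] ∉ S → l (x ++ [c]) = l x)
    (y : List Bool) (hy : y ∈ rest t S) : l y = l0 := by
  induction y using List.reverseRecOn with
  | nil =>
    simp only [rest, Finset.mem_filter] at hy
    exact h5 hy.1 (fun h => hy.2 _ h (List.prefix_refl _))
  | append_singleton y c ih =>
    simp only [rest, Finset.mem_filter] at hy ih
    obtain ⟨h1, h3⟩ := hy
    rw [h6 y c h1 (fun h => h3 _ h (List.prefix_refl _))]
    apply ih
    refine ⟨(mem_pos _ _).2 (valid_init _ _ _ ((mem_pos _ _).1 h1)), ?_⟩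
    intro x hx hxy
    exact h3 x hx (hxy.trans (List.prefix_append _ _))

/-- weight of path components -/
lemma path_weight {ι : Type} (q : ℕ) (hq : 4 ≤ q) (A : Finset ι) (hA : A.Nonempty) (rem : ι → ℕ)
    (h1 : ∀ i ∈ A, 1 ≤ rem i) (h4 : ∑ i ∈ A, rem i ≤ 4 * q) :
    ∑ i ∈ A, (rem i - 1) / q ≤ wt q (∑ i ∈ A, rem i) ∧
    (∑ i ∈ A, (rem i - 1) / q = wt q (∑ i ∈ A, rem i) →
      wt q (∑ i ∈ A, rem i) = 3 ∧ 3 * q < ∑ i ∈ A, rem i) := by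
  have e1 : (∑ i ∈ A, (rem i - 1) / q) * q + A.card ≤ ∑ i ∈ A, rem i := by
    rw [Finset.sum_mul, Finset.card_eq_sum_ones, ← Finset.sum_add_distrib]
    apply Finset.sum_le_sum
    intro i hi
    have := h1 i hi
    have := Nat.div_mul_le_self (rem i - 1) q
    omega
  have e2 := Finset.card_pos.2 hA
  generalize ∑ i ∈ A, (rem i - 1) / q = G at *
  generalize ∑ i ∈ A, rem i = M at *
  have e3 : G ≤ 3 := by
    by_contra h
    have := Nat.mul_le_mul_right q (by omega : 4 ≤ G)
    omega
  have := wt_cases q M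
  interval_cases G <;> omega

lemma finish (k q : ℕ) (a : Fin (3*k) → ℕ) (ha : ∀ i, q + 6 ≤ a i ∧ a i + 18 ≤ 2 * q)
    (lp m : Fin (3*k) → Fin (4*k))
    (h : ∀ g, ∑ i, (if lp i = g then 4 * q else 0) + ∑ i, (if m i = g then a i else 0) = 4 * q) :
    ∃ g : Fin (3*k) → Fin k, ∀ j : Fin k,
        (Finset.univ.filter (fun i => g i = j)).card = 3 ∧
        ∑ i ∈ Finset.univ.filter (fun i => g i = j), a i = 4 * q := by
  have hne : ∀ i j, m i ≠ lp j := by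
    intro i j hij
    have h0 := h (lp j)
    have h1 := Finset.single_le_sum (f := fun i => if lp i = lp j then 4 * q else 0)
      (fun i _ => Nat.zero_le _) (Finset.mem_univ j)
    have h2 := Finset.single_le_sum (f := fun i => if m i = lp j then a i else 0)
      (fun i _ => Nat.zero_le _) (Finset.mem_univ i)
    simp only [hij, if_true] at h1 h2
    have := ha i
    omega
  have hinj : Function.Injective lp := by
    intro i j hij
    by_contra hne
    have h0 := h (lp j)
    have h1 := Finset.sum_le_sum_of_subset (f := fun i => if lp i = lp j then 4 * q else 0)
      (Finset.subset_univ {i, j})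
    rw [Finset.sum_pair hne] at h1
    simp only [hij, if_true] at h1
    have := ha i
    omega
  classical
  have hcard : Fintype.card {g : Fin (4*k) // g ∉ Set.range lp} = k := by
    rw [Fintype.card_subtype_compl]
    have : Fintype.card {x // x ∈ Set.range lp} = 3 * k := by
      rw [← Fintype.card_congr (Equiv.ofInjective lp hinj), Fintype.card_fin]
    rw [this, Fintype.card_fin]
    omega
  let e := Fintype.equivFinOfCardEq hcard
  refine ⟨fun i => e ⟨m i, by rintro ⟨j, hj⟩; exact hne i j hj.symm⟩, fun j => ?_⟩
  have hf : (Finset.univ.filter (fun i => e ⟨m i, by rintro ⟨j, hj⟩; exact hne i j hj.symm⟩ = j)) =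
      Finset.univ.filter (fun i => m i = (e.symm j).1) := by
    apply Finset.filter_congr
    intro i _
    rw [← Equiv.eq_symm_apply, Subtype.ext_iff]
  rw [hf]
  have hs : ∑ i ∈ Finset.univ.filter (fun i => m i = (e.symm j).1), a i = 4 * q := by
    have h0 := h (e.symm j).1
    rw [Finset.sum_filter]
    have : ∑ i, (if lp i = (e.symm j).1 then 4 * q else 0) = 0 := by
      apply Finset.sum_eq_zero
      intro i _
      rw [if_neg]
      intro hi
      exact (e.symm j).2 ⟨i, hi⟩
    omega
  refine ⟨?_, hs⟩
  have u1 := Finset.card_nsmul_le_sum (Finset.univ.filter (fun i => m i = (e.symm j).1)) a (q + 6)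
    (fun i _ => (ha i).1)
  have u2 := Finset.sum_le_card_nsmul (Finset.univ.filter (fun i => m i = (e.symm j).1)) a (2 * q - 18)
    (fun i _ => by have := ha i; omega)
  simp only [smul_eq_mul] at u1 u2
  rw [hs] at u1 u2
  have hn : 0 < 3 * k := by have := j.2; omega
  have := ha ⟨0, hn⟩
  generalize (Finset.univ.filter (fun i => m i = (e.symm j).1)).card = c at *
  have c1 : c < 4 := by
    by_contra hc
    have := Nat.mul_le_mul_right (q + 6) (by omega : 4 ≤ c)
    omega
  interval_cases c <;> omega

set_option maxHeartbeats 1000000 in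
lemma backward (k q : ℕ) (hk : 1 ≤ k) (a : Fin (3*k) → ℕ)
    (ha : ∀ i, q + 6 ≤ a i ∧ a i + 18 ≤ 2 * q) (L R : Fin (3*k) → RBT)
    (hL : ∀ i, (L i).IsNice ∧ (L i).size = a i) (hR : ∀ i, (R i).IsNice ∧ (R i).size = 4 * q - 2)
    (h : Comb k (nodes L R) (6*k-1) (4*k) (4*q)) :
    ∃ g : Fin (3*k) → Fin k, ∀ j : Fin k,
        (Finset.univ.filter (fun i => g i = j)).card = 3 ∧
        ∑ i ∈ Finset.univ.filter (fun i => g i = j), a i = 4 * q := by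
  have hq : 24 ≤ q := by have := ha ⟨0, by omega⟩; omega
  obtain ⟨cP, S, lp, l, h1, h2, h3, h4, h5, h6, h7⟩ := h
  obtain ⟨tp, htp⟩ := exists_tp cP lp h4
  -- basic quantities
  obtain ⟨c, hc⟩ : ∃ c : Fin (3*k) → List Bool → ℕ,
    ∀ i z, c i z = (cell (RBT.node (L i) (R i)) (S i) z).card := ⟨_, fun _ _ => rfl⟩
  obtain ⟨rem, hrem⟩ : ∃ rem : Fin (3*k) → ℕ,
    ∀ i, rem i = (rest (RBT.node (L i) (R i)) (S i)).card + 1 := ⟨_, fun _ => rfl⟩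
  have hcount : ∀ g, ∑ i, (if lp i = g then rem i else 0) +
      ∑ i, ∑ z ∈ S i, (if l i z = g then c i z else 0) = 4 * q := by
    intro g
    rw [← h7 g, Finset.card_filter, ← Finset.sum_add_distrib, ← Finset.sum_add_distrib]
    apply Finset.sum_congr rfl
    intro i _
    have := count_pred (RBT.node (L i) (R i)) (S i) (fun x => l i x = g) (lp i = g)
      (fun z _ y hy => by rw [const_cell _ _ _ (h6 i) z y hy])
      (fun y hy => by rw [const_rest _ _ _ _ (h5 i) (h6 i) y hy])
    simp only [nodes]
    rw [this]
    simp only [hc, hrem]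
    split_ifs <;> omega
  -- path components
  set Q : Finset (Fin (3*k)) := Finset.univ.filter (fun i => i.1 = 0 ∨ i ∈ cP) with hQ
  have hQm : ∀ i, i ∈ Q ↔ (i.1 = 0 ∨ i ∈ cP) := by intro i; simp [hQ]
  have hQcard : Q.card = cP.card + 1 := by
    have : Q = insert (⟨0, by omega⟩ : Fin (3*k)) cP := by
      ext i
      rw [hQm, Finset.mem_insert, Fin.ext_iff]
    rw [this, Finset.card_insert_of_notMem]
    intro hmem
    exact h1 _ hmem rfl
  have htpQ : ∀ i, tp i ∈ Q := fun i => (hQm _).2 (htp i).1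
  set cQ : Fin (3*k) → ℕ := fun t => ∑ i ∈ Finset.univ.filter (fun i => tp i = t), rem i with hcQ
  set Items : Finset (Fin (3*k) ⊕ (Σ _ : Fin (3*k), List Bool)) :=
    Q.disjSum (Finset.univ.sigma S) with hItems
  set f : (Fin (3*k) ⊕ (Σ _ : Fin (3*k), List Bool)) → ℕ := Sum.elim cQ (fun y => c y.1 y.2) with hf
  set Γ : (Fin (3*k) ⊕ (Σ _ : Fin (3*k), List Bool)) → Fin (4*k) :=
    Sum.elim lp (fun y => l y.1 y.2) with hΓ
  have hIQ : ∀ t ∈ Q, Sum.inl t ∈ Items := by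
    intro t ht; simp [hItems, ht]
  have hIS : ∀ i, ∀ z ∈ S i, Sum.inr ⟨i, z⟩ ∈ Items := by
    intro i z hz; simp [hItems, hz]
  have hIcases : ∀ P : (Fin (3*k) ⊕ (Σ _ : Fin (3*k), List Bool)) → Prop,
      (∀ t ∈ Q, P (Sum.inl t)) → (∀ i, ∀ z ∈ S i, P (Sum.inr ⟨i, z⟩)) → ∀ x ∈ Items, P x := by
    intro P p1 p2 x hx
    rcases x with t | ⟨i, z⟩
    · exact p1 t (by simpa [hItems] using hx)
    · exact p2 i z (by simpa [hItems] using hx)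
  have hIsum : ∀ F : (Fin (3*k) ⊕ (Σ _ : Fin (3*k), List Bool)) → ℕ,
      ∑ x ∈ Items, F x = ∑ t ∈ Q, F (Sum.inl t) + ∑ i, ∑ z ∈ S i, F (Sum.inr ⟨i, z⟩) := by
    intro F
    rw [hItems, Finset.sum_disjSum, Finset.sum_sigma]
  have hfib : ∀ F : Fin (3*k) → ℕ,
      ∑ t ∈ Q, ∑ i ∈ Finset.univ.filter (fun i => tp i = t), F i = ∑ i, F i := by
    intro F
    exact Finset.sum_fiberwise_of_maps_to (fun i _ => htpQ i) F
  have hgroup : ∀ g, ∑ x ∈ Items.filter (fun x => Γ x = g), f x = 4 * q := by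
    intro g
    rw [Finset.sum_filter, hIsum, ← hcount g, ← hfib (fun i => if lp i = g then rem i else 0)]
    congr 1
    apply Finset.sum_congr rfl
    intro t ht
    simp only [hΓ, hf, Sum.elim_inl, hcQ]
    split_ifs with hg
    · apply Finset.sum_congr rfl
      intro i hi
      have hi := (Finset.mem_filter.1 hi).2
      rw [if_pos]
      rw [← (htp i).2.1, hi, hg]
    · symm
      apply Finset.sum_eq_zero
      intro i hi
      have hi := (Finset.mem_filter.1 hi).2
      rw [if_neg]
      rw [← (htp i).2.1, hi]
      exact hg
  have hfle : ∀ x ∈ Items, f x ≤ 4 * q := by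
    intro x hx
    rw [← hgroup (Γ x)]
    exact Finset.single_le_sum (f := f) (fun i _ => Nat.zero_le _) (by simp [hx])
  have hcard : Items.card = 6 * k := by
    rw [hItems, Finset.card_disjSum, Finset.card_sigma, hQcard]
    omega
  have hgl := fun g => group_le q (Items.filter (fun x => Γ x = g)) f (hgroup g)
  have hfibI : ∀ F : (Fin (3*k) ⊕ (Σ _ : Fin (3*k), List Bool)) → ℕ,
      ∑ g, ∑ x ∈ Items.filter (fun x => Γ x = g), F x = ∑ x ∈ Items, F x := by
    intro F
    exact Finset.sum_fiberwise _ _ _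
  have hcardsum : ∑ g, 3 * (Items.filter (fun x => Γ x = g)).card = 18 * k := by
    have := hfibI (fun _ => 3)
    simp only [Finset.sum_const, smul_eq_mul, hcard] at this
    rw [Finset.sum_congr rfl (fun g _ => Nat.mul_comm 3 _), this]
    omega
  have hup : ∑ x ∈ Items, wt q (f x) ≤ 18 * k := by
    rw [← hcardsum, ← hfibI]
    exact Finset.sum_le_sum (fun g _ => (hgl g).1)
  -- lower bounds
  have hnon : ∀ t ∈ Q, (Finset.univ.filter (fun i => tp i = t)).Nonempty := by
    intro t ht
    exact ⟨t, by simp [(htp t).2.2 ((hQm t).1 ht)]⟩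
  have hpw := fun t (ht : t ∈ Q) => path_weight q (by omega) (Finset.univ.filter (fun i => tp i = t))
    (hnon t ht) rem (fun i _ => by rw [hrem]; omega) (hfle _ (hIQ t ht))
  have hrem4 : ∀ i, rem i ≤ 4 * q := by
    intro i
    refine le_trans ?_ (hfle _ (hIQ _ (htpQ i)))
    exact Finset.single_le_sum (f := rem) (fun i _ => Nat.zero_le _) (by simp)
  have hloc := fun i => local_lemma q (a i) (L i) (R i) (hL i).1 (hR i).1 (hL i).2 (hR i).2
    (ha i).1 (ha i).2 (S i) (h2 i) (c i) (hc i) (fun z hz => hfle _ (hIS i z hz)) (rem i) (hrem i)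
    (hrem4 i) _ rfl
  have hsumle1 : ∑ t ∈ Q, ∑ i ∈ Finset.univ.filter (fun i => tp i = t), (rem i - 1) / q ≤
      ∑ t ∈ Q, wt q (cQ t) := Finset.sum_le_sum (fun t ht => (hpw t ht).1)
  have hsumle2 : ∑ _i : Fin (3*k), 6 ≤ ∑ i, (∑ z ∈ S i, wt q (c i z) + (rem i - 1) / q) :=
    Finset.sum_le_sum (fun i _ => (hloc i).1)
  have hup' := hup
  rw [hIsum] at hup'
  simp only [hf, Sum.elim_inl, Sum.elim_inr] at hup'
  have hs1 := hfib (fun i => (rem i - 1) / q)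
  have hs2 : ∑ i, (∑ z ∈ S i, wt q (c i z) + (rem i - 1) / q) =
    ∑ i, ∑ z ∈ S i, wt q (c i z) + ∑ i, (rem i - 1) / q := Finset.sum_add_distrib
  have hs3 : ∑ _i : Fin (3*k), 6 = 18 * k := by simp; omega
  have hse1 : ∑ t ∈ Q, ∑ i ∈ Finset.univ.filter (fun i => tp i = t), (rem i - 1) / q =
      ∑ t ∈ Q, wt q (cQ t) := by omega
  have heq1 : ∀ t ∈ Q, ∑ i ∈ Finset.univ.filter (fun i => tp i = t), (rem i - 1) / q =
      wt q (cQ t) :=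
    (Finset.sum_eq_sum_iff_of_le (fun t ht => (hpw t ht).1)).1 hse1
  have heq2 : ∀ i ∈ Finset.univ, 6 = ∑ z ∈ S i, wt q (c i z) + (rem i - 1) / q :=
    (Finset.sum_eq_sum_iff_of_le (fun i _ => (hloc i).1)).1 (by omega)
  have htotal : ∑ x ∈ Items, wt q (f x) = 18 * k := by
    rw [hIsum] at hup ⊢
    simp only [hf, Sum.elim_inl, Sum.elim_inr] at hup ⊢
    omega
  have heq3 : ∀ g ∈ Finset.univ, ∑ x ∈ Items.filter (fun x => Γ x = g), wt q (f x) =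
      3 * (Items.filter (fun x => Γ x = g)).card :=
    (Finset.sum_eq_sum_iff_of_le (fun g _ => (hgl g).1)).1 (by rw [hfibI, hcardsum, htotal])
  have hpath := fun t (ht : t ∈ Q) => (hpw t ht).2 (heq1 t ht)
  have hbeta := fun i => (hloc i).2 (heq2 i (Finset.mem_univ i)).symm
  have hG := fun g => (hgl g).2 (heq3 g (Finset.mem_univ g))
  have hmemg : ∀ x ∈ Items, x ∈ Items.filter (fun y => Γ y = Γ x) := by
    intro x hx; simp [hx]
  have st1 : ∀ x ∈ Items, wt q (f x) = 3 → q ≤ f x := by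
    apply hIcases
    · intro t ht _
      have := (hpath t ht).2
      change q ≤ cQ t
      simp only [hcQ]
      omega
    · intro i z hz hw
      exact (hbeta i).1 z hz hw
  have st2 : ∀ x ∈ Items, wt q (f x) = 3 → f x ≤ 3 * q ∨ f x = 4 * q := by
    intro x hx hw
    by_contra hcon
    have hle := hfle x hx
    obtain ⟨y, hy, hy3, hyq⟩ := (hG (Γ x)).2.2 x (hmemg x hx) hw (by omega) (by omega)
    have := st1 y (Finset.mem_filter.1 hy).1 hy3
    omega
  have st3 : ∀ x ∈ Items, wt q (f x) = 5 → f x = 4 * q - 2 := by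
    apply hIcases
    · intro t ht hw
      have h3 : wt q (f (Sum.inl t)) = 3 := (hpath t ht).1
      omega
    · intro i z hz hw
      exact (hbeta i).2.1 z hz hw
  have st4 : ∀ x ∈ Items, wt q (f x) = 1 → f x = 2 := by
    intro x hx hw
    obtain ⟨y, hy, hy5, hyq⟩ := (hG (Γ x)).1 x (hmemg x hx) hw
    have := st3 y (Finset.mem_filter.1 hy).1 hy5
    omega
  have st5 := fun i => (hbeta i).2.2 (fun z hz => st4 _ (hIS i z hz)) (fun z hz => st2 _ (hIS i z hz))
  choose x hx using st5
  have hxS : ∀ i, x i ∈ S i := by intro i; rw [(hx i).1]; simp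
  have st6 : ∀ y ∈ Items, wt q (f y) ≠ 1 := by
    apply hIcases
    · intro t ht hw
      have h3 : wt q (f (Sum.inl t)) = 3 := (hpath t ht).1
      omega
    · intro i z hz hw
      rw [(hx i).1, Finset.mem_singleton] at hz
      subst hz
      change wt q (c i (x i)) = 1 at hw
      have := (hx i).2
      omega
  have st7 : ∀ i, wt q (c i (x i)) = 3 := by
    intro i
    rcases (hx i).2 with h | h
    · exfalso
      obtain ⟨y, hy, hy1⟩ := (hG _).2.1 _ (hmemg _ (hIS i (x i) (hxS i))) h
      exact st6 y (Finset.mem_filter.1 hy).1 hy1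
    · exact h
  have st8 : ∀ i, (rem i - 1) / q = 3 := by
    intro i
    have := heq2 i (Finset.mem_univ i)
    rw [(hx i).1, Finset.sum_singleton, st7] at this
    omega
  have st9 : ∀ i, rem i = 4 * q := by
    intro i
    have hw := heq1 (tp i) (htpQ i)
    have hp := hpath (tp i) (htpQ i)
    have h42 := st2 _ (hIQ _ (htpQ i)) hp.1
    change cQ (tp i) ≤ 3 * q ∨ cQ (tp i) = 4 * q at h42
    have h43 : 3 * q < cQ (tp i) := hp.2
    have h44 : wt q (cQ (tp i)) = 3 := hp.1
    rw [Finset.sum_congr rfl (fun j _ => st8 j), h44] at hw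
    simp only [Finset.sum_const, smul_eq_mul] at hw
    have hone : (Finset.univ.filter (fun j => tp j = tp i)).card = 1 := by omega
    obtain ⟨y, hy⟩ := Finset.card_eq_one.1 hone
    have hyi : i ∈ Finset.univ.filter (fun j => tp j = tp i) := by simp
    rw [hy, Finset.mem_singleton] at hyi
    have : cQ (tp i) = rem i := by
      simp only [hcQ]
      rw [hy, Finset.sum_singleton, hyi]
    omega
  have st10 : ∀ i, c i (x i) = a i := by
    intro i
    have := total_cells (RBT.node (L i) (R i)) (S i)
    simp only [← hc, RBT.size, (hL i).2, (hR i).2] at this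
    rw [(hx i).1, Finset.sum_singleton, ← (hx i).1] at this
    have := st9 i
    have := hrem i
    omega
  apply finish k q a ha lp (fun i => l i (x i))
  intro g
  have := hcount g
  simp only [st9] at this
  refine Eq.trans ?_ this
  congr 1
  apply Finset.sum_congr rfl
  intro i _
  rw [(hx i).1, Finset.sum_singleton, st10]


end TPX

/-- Theorem 1 of the paper (correctness of the reduction): the multiset `⟨a_1, …, a_{3k}⟩`
can be partitioned into `k` triples each summing to `s` if and only if the instance
`(T, 6k−1, 4k)` of Balanced Degree-3 Tree Partitioning has a solution. -/
theorem statement4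
    (k s : ℕ) (hk : 1 ≤ k) (hs4 : 4 ∣ s) (hs : 24 * k < s)
    (a : Fin (3*k) → ℕ) (ha : ∀ i, s / 4 + 6 * k ≤ a i ∧ a i ≤ s / 2 - 18 * k)
    (Lsh Rsh : Fin (3*k) → RBT)
    (hL : ∀ i, (Lsh i).IsNice ∧ (Lsh i).size = a i)
    (hR : ∀ i, (Rsh i).IsNice ∧ (Rsh i).size = s - 2) :
    (∃ g : Fin (3*k) → Fin k, ∀ j : Fin k,
        (Finset.univ.filter (fun i => g i = j)).card = 3 ∧
        ∑ i ∈ Finset.univ.filter (fun i => g i = j), a i = s) ↔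
    (∃ (EP : Set (Sym2 (Vtx k (nodes Lsh Rsh)))) (lam : Vtx k (nodes Lsh Rsh) → Fin (4*k)),
        IsSolutionEq (TGraph k (nodes Lsh Rsh)) EP (6*k - 1) (4*k) (fun _ => s) lam) := by
  obtain ⟨q, rfl⟩ := hs4
  have e1 : 4 * q / 4 = q := by omega
  have e2 : 4 * q / 2 = 2 * q := by omega
  rw [TPX.mid_iff]
  constructor
  · rintro ⟨g, hg⟩
    apply TPX.mid_of_comb
    exact TPX.forward k (4 * q) hk hs a Lsh Rsh (fun i => (hL i).2)
      (fun i => by have := ha i; omega) (fun i => (hR i).2) g (fun j => (hg j).2)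
  · intro h
    exact TPX.backward k q hk a (fun i => by have := ha i; omega) Lsh Rsh hL hR
      (TPX.comb_of_mid _ _ _ h)
end

section
/- If M contains a multicolored k-clique, then the instance I' has a solution. -/
namespace MCC

/-- `k₀ = k + C(k,2)`. -/
def k0 (k : ℕ) : ℕ := k + Nat.choose k 2

/-- `K = k + 3·C(k,2)`, the cut budget. -/
def KK (k : ℕ) : ℕ := k + 3 * Nat.choose k 2

/-- `z = k₀² · n⁵`. -/
def z (k n : ℕ) : ℕ := (k0 k)^2 * n^5

/-- `b_j = k₀^{2j} · z` (`j` is 1-based). -/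
def bb (k n j : ℕ) : ℕ := (k0 k)^(2*j) * z k n

/-- `c_j = k₀^{2(k+j)} · z` (`j` is 1-based). -/
def cc (k n j : ℕ) : ℕ := (k0 k)^(2*(k+j)) * z k n

/-- `c_j^q = c_k · k₀^{2((j−1)k − j(j−1)/2 + q − j)}` (`j, q` are 1-based, `j < q`). -/
def cjq (k n j q : ℕ) : ℕ := cc k n k * (k0 k)^(2*((j-1)*k - j*(j-1)/2 + q - j))

/-- The number of vertices of each copy of the star `S_fix`: `c_{k−1}^k + K + 1`. -/
def fixSize (k n : ℕ) : ℕ := cjq k n (k-1) k + KK k + 1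

/-- The number of vertices of the vertex-gadget star `S_{v_i^j}`:
`c_j − (k−1)·b_j − (k−1)·x_i`, for the vertex `v = (j, i)`. -/
def vgSize (k n : ℕ) (x : Fin n → ℕ) (v : Fin k × Fin n) : ℕ :=
  cc k n (v.1.1 + 1) - (k-1) * bb k n (v.1.1 + 1) - (k-1) * x v.2

/-- The number of vertices of the star `S'_{v_i^j}`: `b_j + x_i`, for the vertex `v = (j, i)`. -/
def spSize (k n : ℕ) (x : Fin n → ℕ) (v : Fin k × Fin n) : ℕ := bb k n (v.1.1 + 1) + x v.2

/-- Index type for the edges of `M`: ordered pairs of adjacent vertices, with the endpoint of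
smaller color first. Each edge of `M` appears exactly once (the coloring being proper). -/
def EIdx (k n : ℕ) (M : SimpleGraph (Fin k × Fin n)) : Type :=
  {p : (Fin k × Fin n) × (Fin k × Fin n) // M.Adj p.1 p.2 ∧ p.1.1 < p.2.1}

/-- The number of vertices of the star `S_e` of the edge-gadget `T_e`: `c_j^q` for an edge `e`
between color classes `j < q`. -/
def seSize (k n : ℕ) {M : SimpleGraph (Fin k × Fin n)} (e : EIdx k n M) : ℕ :=
  cjq k n (e.1.1.1.1 + 1) (e.1.2.1.1 + 1)

/-- The vertex type of the tree `T` of the instance `I'`: the root `r` (the `Unit` summand);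
for each vertex `v` of `M` the star `S_v` (root `none`, leaves `some _`); for each edge `e`
of `M` the edge-gadget `T_e` consisting of the star `S_e` and the two stars `S'` attached to
its two endpoints; and `K+1` copies of the star `S_fix`. -/
abbrev VV (k n : ℕ) (x : Fin n → ℕ) (M : SimpleGraph (Fin k × Fin n)) : Type :=
  Unit ⊕
  (Σ v : Fin k × Fin n, Option (Fin (vgSize k n x v - 1))) ⊕
  (Σ e : EIdx k n M,
    (Option (Fin (seSize k n e - 1)) ⊕ Option (Fin (spSize k n x e.1.1 - 1)) ⊕
      Option (Fin (spSize k n x e.1.2 - 1)))) ⊕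
  (Fin (KK k + 1) × Option (Fin (fixSize k n - 1)))

/-- Classify a vertex of an edge-gadget: which of the three stars it belongs to
(`0` for `S_e`, `1` and `2` for the two `S'`-stars) and whether it is that star's root. -/
def code {A B C : Type} : (Option A ⊕ Option B ⊕ Option C) → ℕ × Bool
  | Sum.inl none => (0, true)
  | Sum.inl (some _) => (0, false)
  | Sum.inr (Sum.inl none) => (1, true)
  | Sum.inr (Sum.inl (some _)) => (1, false)
  | Sum.inr (Sum.inr none) => (2, true)
  | Sum.inr (Sum.inr (some _)) => (2, false)

/-- Adjacency inside an edge-gadget `T_e`: the root `r_e` of `S_e` is joined to the leaves of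
`S_e` and to the roots of the two `S'`-stars, and the root of each `S'`-star is joined to
its leaves. -/
def codeRel : ℕ × Bool → ℕ × Bool → Prop
  | (0, true), (0, false) => True
  | (0, true), (1, true) => True
  | (0, true), (2, true) => True
  | (1, true), (1, false) => True
  | (2, true), (2, false) => True
  | _, _ => False

/-- The (directed) edge relation of the tree `T` of the instance `I'`. -/
def relMCC (k n : ℕ) (x : Fin n → ℕ) (M : SimpleGraph (Fin k × Fin n)) :
    VV k n x M → VV k n x M → Prop
  | Sum.inl _, Sum.inr (Sum.inl ⟨_, d⟩) => d = none
  | Sum.inr (Sum.inl ⟨u, d⟩), Sum.inr (Sum.inl ⟨u', d'⟩) => u = u' ∧ d = none ∧ d' ≠ none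
  | Sum.inl _, Sum.inr (Sum.inr (Sum.inl ⟨_, d⟩)) => code d = (0, true)
  | Sum.inr (Sum.inr (Sum.inl ⟨e, d⟩)), Sum.inr (Sum.inr (Sum.inl ⟨e', d'⟩)) =>
      e = e' ∧ codeRel (code d) (code d')
  | Sum.inl _, Sum.inr (Sum.inr (Sum.inr (_, d))) => d = none
  | Sum.inr (Sum.inr (Sum.inr (c, d))), Sum.inr (Sum.inr (Sum.inr (c', d'))) =>
      c = c' ∧ d = none ∧ d' ≠ none
  | _, _ => False

/-- The tree `T` of the instance `I'`. -/
def TG (k n : ℕ) (x : Fin n → ℕ) (M : SimpleGraph (Fin k × Fin n)) : SimpleGraph (VV k n x M) :=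
  SimpleGraph.fromRel (relMCC k n x M)

/-- The root `r` of `T`. -/
def rootT (k n : ℕ) (x : Fin n → ℕ) (M : SimpleGraph (Fin k × Fin n)) : VV k n x M :=
  Sum.inl ()

/-- The root `r_{v_i^j}` of the vertex-gadget star `S_{v_i^j}`. -/
def vgRoot (k n : ℕ) (x : Fin n → ℕ) (M : SimpleGraph (Fin k × Fin n)) (v : Fin k × Fin n) :
    VV k n x M :=
  Sum.inr (Sum.inl ⟨v, none⟩)

/-- The root `r_e` of the star `S_e` of the edge-gadget `T_e`. -/
def seRoot (k n : ℕ) (x : Fin n → ℕ) {M : SimpleGraph (Fin k × Fin n)} (e : EIdx k n M) :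
    VV k n x M :=
  Sum.inr (Sum.inr (Sum.inl ⟨e, Sum.inl none⟩))

/-- The root `r'_{v_i^j}` of the star `S'` of the lower-colored endpoint of `e`. -/
def sp1Root (k n : ℕ) (x : Fin n → ℕ) {M : SimpleGraph (Fin k × Fin n)} (e : EIdx k n M) :
    VV k n x M :=
  Sum.inr (Sum.inr (Sum.inl ⟨e, Sum.inr (Sum.inl none)⟩))

/-- The root `r'_{v_p^q}` of the star `S'` of the higher-colored endpoint of `e`. -/
def sp2Root (k n : ℕ) (x : Fin n → ℕ) {M : SimpleGraph (Fin k × Fin n)} (e : EIdx k n M) :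
    VV k n x M :=
  Sum.inr (Sum.inr (Sum.inl ⟨e, Sum.inr (Sum.inr none)⟩))

/-- The vertex set of the vertex-gadget star `S_v`. -/
def vgSet (k n : ℕ) (x : Fin n → ℕ) (M : SimpleGraph (Fin k × Fin n)) (v : Fin k × Fin n) :
    Set (VV k n x M) :=
  {w | ∃ d, w = Sum.inr (Sum.inl ⟨v, d⟩)}

/-- The vertex set of the star `S_e` of the edge-gadget `T_e`. -/
def SeSet (k n : ℕ) (x : Fin n → ℕ) {M : SimpleGraph (Fin k × Fin n)} (e : EIdx k n M) :
    Set (VV k n x M) :=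
  {w | ∃ d, w = Sum.inr (Sum.inr (Sum.inl ⟨e, Sum.inl d⟩))}

/-- The groups of the instance `I'`: the groups `G_1, …, G_k`, the groups `G_j^q` for
`1 ≤ j < q ≤ k`, and the group `G_rest`. -/
abbrev Grp (k : ℕ) : Type := Fin k ⊕ {pq : Fin k × Fin k // pq.1 < pq.2} ⊕ Unit

/-- The group `G_j`. -/
def gCol {k : ℕ} (j : Fin k) : Grp k := Sum.inl j

/-- The group `G_j^q`. -/
def gPair {k : ℕ} (pq : {pq : Fin k × Fin k // pq.1 < pq.2}) : Grp k := Sum.inr (Sum.inl pq)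

/-- The group `G_rest`. -/
def gRest (k : ℕ) : Grp k := Sum.inr (Sum.inr ())

/-- `t = |V(T)|`. -/
noncomputable def tTot (k n : ℕ) (x : Fin n → ℕ) (M : SimpleGraph (Fin k × Fin n)) : ℕ :=
  (Set.univ : Set (VV k n x M)).ncard

/-- `t' = t − Σ_j c_j − Σ_{j<q} c_j^q`, the size of the group `G_rest`. -/
noncomputable def tRest (k n : ℕ) (x : Fin n → ℕ) (M : SimpleGraph (Fin k × Fin n)) : ℕ :=
  tTot k n x M - (∑ j : Fin k, cc k n (j.1 + 1)) -
    ∑ pq : {pq : Fin k × Fin k // pq.1 < pq.2}, cjq k n (pq.1.1.1 + 1) (pq.1.2.1 + 1)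

/-- The prescribed sizes of the groups: `G_j` has size `c_j`, `G_j^q` has size `c_j^q`,
and `G_rest` has size `t'`. -/
noncomputable def sizesMCC (k n : ℕ) (x : Fin n → ℕ) (M : SimpleGraph (Fin k × Fin n)) :
    Grp k → ℕ
  | Sum.inl j => cc k n (j.1 + 1)
  | Sum.inr (Sum.inl pq) => cjq k n (pq.1.1.1 + 1) (pq.1.2.1 + 1)
  | Sum.inr (Sum.inr _) => tRest k n x M

/-- A solution cutting at most `kk` edges: `EP` is a set of at most `kk` edges of `T`, and
`lam` assigns the connected components of `T − EP` to the groups (it is constant on each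
component) so that each group `g` receives exactly `sizes g` vertices. -/
def IsSolutionLe {V G : Type} (T : SimpleGraph V) (EP : Set (Sym2 V)) (kk : ℕ)
    (sizes : G → ℕ) (lam : V → G) : Prop :=
  EP ⊆ T.edgeSet ∧ EP.ncard ≤ kk ∧
    (∀ v w : V, (T.deleteEdges EP).Reachable v w → lam v = lam w) ∧
    ∀ g : G, {v | lam v = g}.ncard = sizes g

/-- `C` is a `P`-component: a connected component of `T − EP`. -/
def IsPComp {V : Type} (T : SimpleGraph V) (EP : Set (Sym2 V)) (C : Set V) : Prop :=
  ∃ v : V, C = {w | (T.deleteEdges EP).Reachable v w}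

/-- `M` contains a multicolored `k`-clique: one vertex of each color class, pairwise adjacent. -/
def HasMCClique (k n : ℕ) (M : SimpleGraph (Fin k × Fin n)) : Prop :=
  ∃ sel : Fin k → Fin n, ∀ j j' : Fin k, j ≠ j' → M.Adj (j, sel j) (j', sel j')

/-- The instance `I'` has a solution. -/
def HasSol (k n : ℕ) (x : Fin n → ℕ) (M : SimpleGraph (Fin k × Fin n)) : Prop :=
  ∃ (EP : Set (Sym2 (VV k n x M))) (lam : VV k n x M → Grp k),
    IsSolutionLe (TG k n x M) EP (KK k) (sizesMCC k n x M) lam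

end MCC


namespace MCC

open Classical in
/-- The labelling. -/
noncomputable def lamS (k n : ℕ) (x : Fin n → ℕ) (M : SimpleGraph (Fin k × Fin n))
    (sel : Fin k → Fin n) : VV k n x M → Grp k
  | Sum.inl _ => gRest k
  | Sum.inr (Sum.inl ⟨v, _⟩) => if v.2 = sel v.1 then gCol v.1 else gRest k
  | Sum.inr (Sum.inr (Sum.inl ⟨e, d⟩)) =>
      if e.1.1.2 = sel e.1.1.1 ∧ e.1.2.2 = sel e.1.2.1 then
        (match d with
        | Sum.inl _ => gPair ⟨(e.1.1.1, e.1.2.1), e.2.2⟩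
        | Sum.inr (Sum.inl _) => gCol e.1.1.1
        | Sum.inr (Sum.inr _) => gCol e.1.2.1)
      else gRest k
  | Sum.inr (Sum.inr (Sum.inr _)) => gRest k

abbrev PP (k : ℕ) : Type := {pq : Fin k × Fin k // pq.1 < pq.2}

theorem card_PP (k : ℕ) : Fintype.card (PP k) = Nat.choose k 2 := by
  rw [Fintype.card_subtype, Finset.card_filter, Fintype.sum_prod_type, Finset.sum_comm]
  have : ∀ q : Fin k, (∑ p : Fin k, if (p, q).1 < (p, q).2 then 1 else 0) = (q : ℕ) := by
    intro q
    rw [← Finset.card_filter]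
    have : (Finset.univ.filter fun p : Fin k => p < q) = Finset.Iio q := by ext; simp
    simp [this]
  rw [Finset.sum_congr rfl (fun q _ => this q), Fin.sum_univ_eq_sum_range (fun i => i),
    Finset.sum_range_id, Nat.choose_two_right]

theorem sum_PP (k : ℕ) (j : Fin k) (a : ℕ) :
    (∑ pq : PP k, ((if pq.1.1 = j then a else 0) + (if pq.1.2 = j then a else 0))) =
      (k - 1) * a := by
  have e : (∑ pq : PP k, ((if pq.1.1 = j then a else 0) + (if pq.1.2 = j then a else 0))) =
      ∑ pq ∈ Finset.univ.filter (fun pq : Fin k × Fin k => pq.1 < pq.2),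
        ((if pq.1 = j then a else 0) + (if pq.2 = j then a else 0)) :=
    (Finset.sum_subtype (Finset.univ.filter fun pq : Fin k × Fin k => pq.1 < pq.2)
    (p := fun pq : Fin k × Fin k => pq.1 < pq.2) (by simp)
    (fun pq : Fin k × Fin k => (if pq.1 = j then a else 0) + (if pq.2 = j then a else 0))).symm
  rw [e, Finset.sum_filter]
  have e2 : ∀ pq : Fin k × Fin k, (if pq.1 < pq.2 then
      ((if pq.1 = j then a else 0) + (if pq.2 = j then a else 0)) else 0) =
      (if pq.1 = j then (if j < pq.2 then a else 0) else 0) +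
      (if pq.2 = j then (if pq.1 < j then a else 0) else 0) := by
    rintro ⟨p, q⟩
    simp only
    by_cases h1 : p = j <;> by_cases h2 : q = j <;> simp [h1, h2]
  rw [Finset.sum_congr rfl (fun pq _ => e2 pq), Finset.sum_add_distrib, Fintype.sum_prod_type,
    Fintype.sum_prod_type_right]
  have e3 : (∑ p : Fin k, ∑ q : Fin k, if p = j then (if j < q then a else 0) else 0) =
      ∑ q : Fin k, if j < q then a else 0 := by
    rw [Finset.sum_comm]; simp
  have e4 : (∑ q : Fin k, ∑ p : Fin k, if q = j then (if p < j then a else 0) else 0) =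
      ∑ q : Fin k, if q < j then a else 0 := by
    rw [Finset.sum_comm]; simp
  simp only [e3, e4]
  rw [← Finset.sum_add_distrib]
  have e5 : ∀ q : Fin k, ((if j < q then a else 0) + (if q < j then a else 0)) =
      if q ≠ j then a else 0 := by
    intro q
    rcases lt_trichotomy q j with h | h | h
    · simp [h, h.not_gt, h.ne]
    · simp [h]
    · simp [h, h.not_gt, h.ne']
  rw [Finset.sum_congr rfl (fun q _ => e5 q), ← Finset.sum_filter, Finset.sum_const,
    Finset.filter_ne', Finset.card_erase_of_mem (Finset.mem_univ _)]
  simp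

def selE {k n : ℕ} {M : SimpleGraph (Fin k × Fin n)} (sel : Fin k → Fin n)
    (h : ∀ j j' : Fin k, j ≠ j' → M.Adj (j, sel j) (j', sel j')) (pq : PP k) : EIdx k n M :=
  ⟨((pq.1.1, sel pq.1.1), (pq.1.2, sel pq.1.2)), h _ _ pq.2.ne, pq.2⟩

theorem selE_inj {k n : ℕ} {M : SimpleGraph (Fin k × Fin n)} (sel : Fin k → Fin n)
    (h : ∀ j j' : Fin k, j ≠ j' → M.Adj (j, sel j) (j', sel j')) :
    Function.Injective (selE sel h) := by
  intro a b hab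
  have := congrArg (fun e : EIdx k n M => (e.1.1.1, e.1.2.1)) hab
  exact Subtype.ext this

theorem eq_selE {k n : ℕ} {M : SimpleGraph (Fin k × Fin n)} (sel : Fin k → Fin n)
    (h : ∀ j j' : Fin k, j ≠ j' → M.Adj (j, sel j) (j', sel j')) (e : EIdx k n M)
    (he : e.1.1.2 = sel e.1.1.1 ∧ e.1.2.2 = sel e.1.2.1) :
    e = selE sel h ⟨(e.1.1.1, e.1.2.1), e.2.2⟩ := by
  obtain ⟨⟨⟨a, b⟩, ⟨c, d⟩⟩, h1, h2⟩ := e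
  simp only at he
  obtain ⟨rfl, rfl⟩ := he
  rfl

theorem k0_ge {k : ℕ} (hk : 2 ≤ k) : k + 1 ≤ k0 k := by
  have := Nat.choose_pos hk
  unfold k0; omega

theorem z_pos {k n : ℕ} (hk : 2 ≤ k) (hn : 1 ≤ n) : 0 < z k n := by
  have := k0_ge hk
  have : 0 < k0 k := by omega
  unfold z; positivity

theorem bb_pos {k n : ℕ} (hk : 2 ≤ k) (hn : 1 ≤ n) (j : ℕ) : 0 < bb k n j := by
  have := k0_ge hk
  have : 0 < k0 k := by omega
  have := z_pos hk hn
  unfold bb; positivity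

theorem cjq_pos {k n : ℕ} (hk : 2 ≤ k) (hn : 1 ≤ n) (j q : ℕ) : 0 < cjq k n j q := by
  have := k0_ge hk
  have : 0 < k0 k := by omega
  have := z_pos hk hn
  unfold cjq cc; positivity

theorem x_le_bb {k n : ℕ} (hk : 2 ≤ k) (hn : 1 ≤ n) (j : ℕ) (a : ℕ) (ha : a ≤ n ^ 4) :
    a ≤ bb k n j := by
  have := k0_ge hk
  have h0 : 0 < k0 k := by omega
  have h1 : n ^ 4 ≤ n ^ 5 := Nat.pow_le_pow_right hn (by norm_num)
  have h2 : 0 < k0 k ^ 2 := by positivity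
  have h3 : 0 < k0 k ^ (2 * j) := by positivity
  unfold bb z
  calc a ≤ n ^ 5 := ha.trans h1
    _ ≤ k0 k ^ 2 * n ^ 5 := Nat.le_mul_of_pos_left _ h2
    _ ≤ _ := Nat.le_mul_of_pos_left _ h3

theorem cc_eq (k n j : ℕ) : cc k n j = k0 k ^ (2 * k) * bb k n j := by
  unfold cc bb; rw [Nat.mul_add, pow_add, mul_assoc]

theorem vg_bound {k n : ℕ} (hk : 2 ≤ k) (hn : 1 ≤ n) (j : ℕ) (a : ℕ) (ha : a ≤ n ^ 4) :
    (k - 1) * (bb k n j + a) < cc k n j := by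
  have hb := bb_pos hk hn j
  have hx := x_le_bb hk hn j a ha
  have h0 := k0_ge hk
  have h4 : k0 k ^ 2 ≤ k0 k ^ (2 * k) := Nat.pow_le_pow_right (by omega) (by omega)
  have h5 : 2 * k < k0 k ^ 2 := by nlinarith
  rw [cc_eq]
  calc (k - 1) * (bb k n j + a) ≤ k * (2 * bb k n j) := Nat.mul_le_mul (by omega) (by omega)
    _ = (2 * k) * bb k n j := by ring
    _ < k0 k ^ (2 * k) * bb k n j := Nat.mul_lt_mul_of_pos_right (by omega) hb

theorem card_opt (m : ℕ) (h : 0 < m) : Fintype.card (Option (Fin (m - 1))) = m := by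
  simp; omega

theorem sum_opt {m : ℕ} (hm : 0 < m) (f : Option (Fin (m - 1)) → ℕ) (c : ℕ)
    (hf : ∀ d, f d = c) : ∑ d, f d = m * c := by
  rw [Finset.sum_congr rfl (fun d _ => hf d), Finset.sum_const, Finset.card_univ, card_opt _ hm,
    smul_eq_mul]

noncomputable instance (k n : ℕ) (M : SimpleGraph (Fin k × Fin n)) : Fintype (EIdx k n M) := by
  classical
  unfold EIdx
  infer_instance

open Classical in
theorem sum_sel {k n : ℕ} {M : SimpleGraph (Fin k × Fin n)} (sel : Fin k → Fin n)
    (h : ∀ j j' : Fin k, j ≠ j' → M.Adj (j, sel j) (j', sel j')) (F : EIdx k n M → ℕ) :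
    (∑ e : EIdx k n M, if e.1.1.2 = sel e.1.1.1 ∧ e.1.2.2 = sel e.1.2.1 then F e else 0) =
      ∑ pq : PP k, F (selE sel h pq) := by
  symm
  apply Fintype.sum_of_injective (selE sel h) (selE_inj sel h)
  · intro e he
    rw [if_neg]
    intro hs
    exact he ⟨_, (eq_selE sel h e hs).symm⟩
  · intro pq
    simp [selE]

open Classical in
theorem ncard_fib (k n : ℕ) (x : Fin n → ℕ) (M : SimpleGraph (Fin k × Fin n))
    (sel : Fin k → Fin n) (hk : 2 ≤ k) (hn : 1 ≤ n) (hxbd : ∀ i, x i ≤ n^4)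
    (h : ∀ j j' : Fin k, j ≠ j' → M.Adj (j, sel j) (j', sel j')) (g : Grp k)
    (hg : g ≠ gRest k) :
    {v | lamS k n x M sel v = g}.ncard =
      (∑ j, if gCol j = g then vgSize k n x (j, sel j) else 0) +
      ∑ pq : PP k, ((if gPair pq = g then cjq k n (pq.1.1.1+1) (pq.1.2.1+1) else 0) +
        ((if gCol pq.1.1 = g then spSize k n x (pq.1.1, sel pq.1.1) else 0) +
        (if gCol pq.1.2 = g then spSize k n x (pq.1.2, sel pq.1.2) else 0))) := by
  have hvg : ∀ v, 0 < vgSize k n x v := by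
    intro v
    have := vg_bound hk hn (v.1.1 + 1) _ (hxbd v.2)
    rw [Nat.mul_add] at this
    unfold vgSize; omega
  have hsp : ∀ v, 0 < spSize k n x v := by
    intro v
    have := bb_pos hk hn (v.1.1 + 1)
    unfold spSize; omega
  have hse : ∀ e : EIdx k n M, 0 < seSize k n e := fun e => cjq_pos hk hn _ _
  rw [Set.ncard_eq_toFinset_card', Set.toFinset_ofPred, Finset.card_filter]
  rw [Fintype.sum_sum_type, Fintype.sum_sum_type, Fintype.sum_sum_type,
    Fintype.sum_sigma, Fintype.sum_sigma]
  have e1 : (∑ a : Unit, if lamS k n x M sel (Sum.inl a) = g then 1 else 0) = 0 := by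
    simp [lamS, hg.symm]
  have e4 : (∑ a : Fin (KK k + 1) × Option (Fin (fixSize k n - 1)),
      if lamS k n x M sel (Sum.inr (Sum.inr (Sum.inr a))) = g then 1 else 0) = 0 := by
    simp [lamS, hg.symm]
  rw [e1, e4, zero_add, add_zero]
  congr 1
  · have : ∀ v : Fin k × Fin n, (∑ d : Option (Fin (vgSize k n x v - 1)),
        if lamS k n x M sel (Sum.inr (Sum.inl ⟨v, d⟩)) = g then 1 else 0) =
        if v.2 = sel v.1 then (if gCol v.1 = g then vgSize k n x v else 0) else 0 := by
      intro v
      by_cases hs : v.2 = sel v.1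
      · rw [sum_opt (hvg v) _ (if gCol v.1 = g then 1 else 0) (fun d => by simp [lamS, hs])]
        simp [hs]
      · rw [sum_opt (hvg v) _ 0 (fun d => by simp [lamS, hs, hg.symm])]
        simp [hs]
    rw [Finset.sum_congr rfl (fun v _ => this v), Fintype.sum_prod_type]
    simp
  · refine Eq.trans ?_ (sum_sel sel h (fun e =>
        (if gPair ⟨(e.1.1.1, e.1.2.1), e.2.2⟩ = g then seSize k n e else 0) +
        ((if gCol e.1.1.1 = g then spSize k n x e.1.1 else 0) +
        (if gCol e.1.2.1 = g then spSize k n x e.1.2 else 0))))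
    apply Finset.sum_congr rfl
    intro e _
    rw [Fintype.sum_sum_type, Fintype.sum_sum_type]
    by_cases hs : e.1.1.2 = sel e.1.1.1 ∧ e.1.2.2 = sel e.1.2.1
    · rw [sum_opt (hse e) _ (if gPair ⟨(e.1.1.1, e.1.2.1), e.2.2⟩ = g then 1 else 0)
          (fun d => by simp only [lamS, if_pos hs]),
        sum_opt (hsp _) _ (if gCol e.1.1.1 = g then 1 else 0)
          (fun d => by simp only [lamS, if_pos hs]),
        sum_opt (hsp _) _ (if gCol e.1.2.1 = g then 1 else 0)
          (fun d => by simp only [lamS, if_pos hs]), if_pos hs]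
      simp only [mul_ite, mul_one, mul_zero]
    · rw [sum_opt (hse e) _ 0 (fun d => by simp only [lamS, if_neg hs, if_neg hg.symm]),
        sum_opt (hsp _) _ 0 (fun d => by simp only [lamS, if_neg hs, if_neg hg.symm]),
        sum_opt (hsp _) _ 0 (fun d => by simp only [lamS, if_neg hs, if_neg hg.symm]), if_neg hs]
      simp only [mul_zero, add_zero]

/-- Candidate cut edges. -/
def cutE {k n : ℕ} (x : Fin n → ℕ) {M : SimpleGraph (Fin k × Fin n)} (sel : Fin k → Fin n)
    (h : ∀ j j' : Fin k, j ≠ j' → M.Adj (j, sel j) (j', sel j')) :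
    Fin k ⊕ (PP k ⊕ PP k ⊕ PP k) → Sym2 (VV k n x M)
  | Sum.inl j => s(rootT k n x M, vgRoot k n x M (j, sel j))
  | Sum.inr (Sum.inl p) => s(rootT k n x M, seRoot k n x (selE sel h p))
  | Sum.inr (Sum.inr (Sum.inl p)) => s(seRoot k n x (selE sel h p), sp1Root k n x (selE sel h p))
  | Sum.inr (Sum.inr (Sum.inr p)) => s(seRoot k n x (selE sel h p), sp2Root k n x (selE sel h p))

theorem rel_cut {k n : ℕ} (x : Fin n → ℕ) {M : SimpleGraph (Fin k × Fin n)} (sel : Fin k → Fin n)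
    (h : ∀ j j' : Fin k, j ≠ j' → M.Adj (j, sel j) (j', sel j')) (v w : VV k n x M)
    (hr : relMCC k n x M v w) (hl : lamS k n x M sel v ≠ lamS k n x M sel w) :
    s(v, w) ∈ Set.range (cutE x sel h) := by
  rcases v with _ | ⟨u, d⟩ | ⟨e, d⟩ | ⟨c, d⟩ <;> rcases w with _ | ⟨u', d'⟩ | ⟨e', d'⟩ | ⟨c', d'⟩ <;>
    simp only [relMCC] at hr
  · subst hr
    simp only [lamS] at hl
    split_ifs at hl with hs
    · refine ⟨Sum.inl u'.1, ?_⟩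
      obtain ⟨a, b⟩ := u'
      simp only at hs
      subst hs
      rfl
    · exact absurd rfl hl
  · simp only [lamS] at hl
    split_ifs at hl with hs
    · have := eq_selE sel h e' hs
      rcases d' with (_ | _) | (_ | _) | (_ | _) <;> simp [code] at hr
      refine ⟨Sum.inr (Sum.inl ⟨(e'.1.1.1, e'.1.2.1), e'.2.2⟩), ?_⟩
      simp only [cutE]
      rw [← this]
      rfl
    · exact absurd rfl hl
  · exact absurd rfl hl
  · obtain ⟨rfl, -⟩ := hr
    exact absurd rfl hl
  · obtain ⟨rfl, hr⟩ := hr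
    by_cases hs : e.1.1.2 = sel e.1.1.1 ∧ e.1.2.2 = sel e.1.2.1
    · have := eq_selE sel h e hs
      rcases d with (_ | _) | (_ | _) | (_ | _) <;> rcases d' with (_ | _) | (_ | _) | (_ | _) <;>
        simp [code, codeRel] at hr <;> simp [lamS] at hl
      · refine ⟨Sum.inr (Sum.inr (Sum.inl ⟨(e.1.1.1, e.1.2.1), e.2.2⟩)), ?_⟩
        simp only [cutE]
        rw [← this]
        rfl
      · refine ⟨Sum.inr (Sum.inr (Sum.inr ⟨(e.1.1.1, e.1.2.1), e.2.2⟩)), ?_⟩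
        simp only [cutE]
        rw [← this]
        rfl
    · simp [lamS, hs] at hl
  · exact absurd rfl hl

end MCC

open MCC

/-- If `M` contains a multicolored `k`-clique, then the instance `I'` has a solution. -/
theorem statement5
    (k n : ℕ) (hk : 2 ≤ k) (hn : 1 ≤ n)
    (x : Fin n → ℕ) (hxinj : Function.Injective x) (hxbd : ∀ i, x i ≤ n^4)
    (hxna : ∀ (g : Fin (k-1) → Fin n) (i : Fin n),
      (∑ j, x (g j)) = (k-1) * x i → ∀ j, x (g j) = x i)
    (M : SimpleGraph (Fin k × Fin n)) (hM : ∀ u w, M.Adj u w → u.1 ≠ w.1) :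
    HasMCClique k n M → HasSol k n x M := by
  classical
  rintro ⟨sel, h⟩
  refine ⟨{e ∈ (TG k n x M).edgeSet | ∃ v w, e = s(v, w) ∧ lamS k n x M sel v ≠ lamS k n x M sel w},
    lamS k n x M sel, fun e he => he.1, ?_, ?_, ?_⟩
  · have hsub : {e ∈ (TG k n x M).edgeSet | ∃ v w, e = s(v, w) ∧
        lamS k n x M sel v ≠ lamS k n x M sel w} ⊆ Set.range (cutE x sel h) := by
      rintro e ⟨he, v, w, rfl, hl⟩
      rw [SimpleGraph.mem_edgeSet, TG, SimpleGraph.fromRel_adj] at he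
      rcases he.2 with hr | hr
      · exact rel_cut x sel h v w hr hl
      · rw [Sym2.eq_swap]
        exact rel_cut x sel h w v hr hl.symm
    refine (Set.ncard_le_ncard hsub (Set.finite_range _)).trans ?_
    rw [← Set.image_univ]
    refine (Set.ncard_image_le Set.finite_univ).trans ?_
    rw [Set.ncard_univ, Nat.card_eq_fintype_card]
    simp only [Fintype.card_sum, card_PP, Fintype.card_fin, KK]
    omega
  · intro v w hvw
    obtain ⟨p⟩ := hvw
    induction p with
    | nil => rfl
    | cons hadj _ ih =>
      rw [← ih]
      rw [SimpleGraph.deleteEdges_adj] at hadj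
      by_contra hne
      exact hadj.2 ⟨hadj.1, _, _, rfl, hne⟩
  · have hcol : ∀ j : Fin k, {v | lamS k n x M sel v = gCol j}.ncard = cc k n (j.1 + 1) := by
      intro j
      rw [ncard_fib k n x M sel hk hn hxbd h _ (by simp [gCol, gRest])]
      have h1 := vg_bound hk hn (j.1 + 1) _ (hxbd (sel j))
      have h2 := sum_PP k j (spSize k n x (j, sel j))
      have h3 : (∑ pq : PP k, ((if gPair pq = gCol j then cjq k n (pq.1.1.1+1) (pq.1.2.1+1) else 0) +
        ((if gCol pq.1.1 = gCol j then spSize k n x (pq.1.1, sel pq.1.1) else 0) +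
        (if gCol pq.1.2 = gCol j then spSize k n x (pq.1.2, sel pq.1.2) else 0)))) =
        (k - 1) * spSize k n x (j, sel j) := by
        rw [← h2]
        apply Finset.sum_congr rfl
        intro pq _
        have hi : ∀ a b : Fin k, (gCol a = gCol b) ↔ a = b := by simp [gCol]
        simp only [hi]
        rw [if_neg (by simp [gPair, gCol]), zero_add]
        congr 1
        · split_ifs with hh
          · rw [hh]
          · rfl
        · split_ifs with hh
          · rw [hh]
          · rfl
      rw [h3]
      simp only [gCol, Sum.inl.injEq, Finset.sum_ite_eq', Finset.mem_univ, if_true]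
      unfold vgSize spSize
      rw [Nat.mul_add] at h1 ⊢
      simp only
      omega
    have hpair : ∀ pq : PP k, {v | lamS k n x M sel v = gPair pq}.ncard =
        cjq k n (pq.1.1.1 + 1) (pq.1.2.1 + 1) := by
      intro pq
      rw [ncard_fib k n x M sel hk hn hxbd h _ (by simp [gPair, gRest])]
      simp only [gCol, gPair, reduceCtorEq, if_false, Sum.inr.injEq, Sum.inl.injEq, add_zero,
        Finset.sum_const_zero, zero_add, Finset.sum_ite_eq', Finset.mem_univ, if_true]
    rintro (j | pq | u)
    · exact hcol j
    · exact hpair pq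
    · have htot : tTot k n x M = ∑ g : Grp k, {v | lamS k n x M sel v = g}.ncard := by
        rw [tTot, Set.ncard_univ, Nat.card_eq_fintype_card, ← Finset.card_univ,
          Finset.card_eq_sum_card_fiberwise (f := lamS k n x M sel) (t := Finset.univ) (by simp)]
        apply Finset.sum_congr rfl
        intro g _
        rw [Set.ncard_eq_toFinset_card', Set.toFinset_ofPred]
      rw [Fintype.sum_sum_type, Fintype.sum_sum_type] at htot
      have a1 : ∀ j : Fin k, {v | lamS k n x M sel v = Sum.inl j}.ncard = cc k n (j.1 + 1) := hcol
      have a2 : ∀ pq : PP k, {v | lamS k n x M sel v = Sum.inr (Sum.inl pq)}.ncard =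
        cjq k n (pq.1.1.1 + 1) (pq.1.2.1 + 1) := hpair
      simp only [a1, a2, Finset.univ_unique, Finset.sum_singleton] at htot
      simp only [sizesMCC, tRest]
      rw [htot]
      have : u = default := rfl
      rw [this]
      omega
end

section
/- Every solution P = (E_P, λ_P) of the instance I' assigns the root r of T to the group G_rest. -/
open MCC

theorem k0_pos (k : ℕ) (hk : 2 ≤ k) : 0 < k0 k := by unfold k0; omega

theorem expo_le (k j q : ℕ) (hjq : j < q) (hq : q < k) :
    (j + 1 - 1) * k - (j + 1) * (j + 1 - 1) / 2 + (q + 1) - (j + 1) ≤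
      (k - 1 - 1) * k - (k - 1) * (k - 1 - 1) / 2 + k - (k - 1) := by
  obtain ⟨d, rfl⟩ : ∃ d, k = j + d + 2 := ⟨k - 2 - j, by omega⟩
  have e1 : j + d + 2 - 1 = j + d + 1 := by omega
  rw [e1]
  simp only [Nat.add_sub_cancel]
  have h1 : 2 * ((j + 1) * j / 2) = (j + 1) * j := by
    apply Nat.mul_div_cancel'
    rw [mul_comm]; exact (Nat.even_mul_succ_self j).two_dvd
  have h2 : 2 * ((j + d + 1) * (j + d) / 2) = (j + d + 1) * (j + d) := by
    apply Nat.mul_div_cancel'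
    rw [mul_comm]; exact (Nat.even_mul_succ_self (j + d)).two_dvd
  generalize (j + 1) * j / 2 = A at *
  generalize (j + d + 1) * (j + d) / 2 = B at *
  have h3 : A ≤ j * (j + d + 2) := by nlinarith
  have h4 : B ≤ (j + d) * (j + d + 2) := by nlinarith
  have h5 : j * (j + d + 2) + B + d ≤ (j + d) * (j + d + 2) + A := by nlinarith
  omega

theorem cjq_le (k n j q : ℕ) (hk : 2 ≤ k) (hjq : j < q) (hq : q < k) :
    cjq k n (j + 1) (q + 1) ≤ cjq k n (k - 1) k := by
  unfold cjq
  exact Nat.mul_le_mul_left _ (Nat.pow_le_pow_right (k0_pos k hk)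
    (Nat.mul_le_mul_left 2 (expo_le k j q hjq hq)))

theorem cc_le (k n j : ℕ) (hk : 2 ≤ k) (hj : j < k) :
    cc k n (j + 1) ≤ cjq k n (k - 1) k := by
  unfold cjq
  refine le_trans ?_ (Nat.le_mul_of_pos_right _ (pow_pos (k0_pos k hk) _))
  unfold cc
  exact Nat.mul_le_mul_right _ (Nat.pow_le_pow_right (k0_pos k hk) (by omega))

theorem adj_root (k n : ℕ) (x : Fin n → ℕ) (M : SimpleGraph (Fin k × Fin n))
    (c : Fin (KK k + 1)) :
    (TG k n x M).Adj (rootT k n x M) (Sum.inr (Sum.inr (Sum.inr (c, none)))) := by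
  simp [TG, SimpleGraph.fromRel_adj, rootT, relMCC]

theorem adj_leaf (k n : ℕ) (x : Fin n → ℕ) (M : SimpleGraph (Fin k × Fin n))
    (c : Fin (KK k + 1)) (d : Fin (fixSize k n - 1)) :
    (TG k n x M).Adj (Sum.inr (Sum.inr (Sum.inr (c, none))))
      (Sum.inr (Sum.inr (Sum.inr (c, some d)))) := by
  simp [TG, SimpleGraph.fromRel_adj, relMCC]

theorem same_copy (k n : ℕ) (x : Fin n → ℕ) (M : SimpleGraph (Fin k × Fin n))
    (c c' : Fin (KK k + 1)) (d d' : Option (Fin (fixSize k n - 1)))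
    (h : (TG k n x M).Adj (Sum.inr (Sum.inr (Sum.inr (c, d))))
      (Sum.inr (Sum.inr (Sum.inr (c', d'))))) : c = c' := by
  simp [TG, SimpleGraph.fromRel_adj, relMCC] at h
  rcases h.2 with h | h
  · exact h.1
  · exact h.1.symm

/-- Observation 1 of the paper: every solution of the instance `I'` assigns the root `r`
of `T` to the group `G_rest`. -/
theorem statement6
    (k n : ℕ) (hk : 2 ≤ k) (hn : 1 ≤ n)
    (x : Fin n → ℕ) (hxinj : Function.Injective x) (hxbd : ∀ i, x i ≤ n^4)
    (hxna : ∀ (g : Fin (k-1) → Fin n) (i : Fin n),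
      (∑ j, x (g j)) = (k-1) * x i → ∀ j, x (g j) = x i)
    (M : SimpleGraph (Fin k × Fin n)) (hM : ∀ u w, M.Adj u w → u.1 ≠ w.1)
    (EP : Set (Sym2 (VV k n x M))) (lam : VV k n x M → Grp k)
    (hP : IsSolutionLe (TG k n x M) EP (KK k) (sizesMCC k n x M) lam) :
    lam (rootT k n x M) = gRest k := by
  obtain ⟨hE, hcard, hconst, hsz⟩ := hP
  haveI : Finite (EIdx k n M) := by unfold EIdx; infer_instance
  -- a copy of the fixing star that no deleted edge touches
  have hfree : ∃ c : Fin (KK k + 1), ∀ e ∈ EP, ∀ d, (Sum.inr (Sum.inr (Sum.inr (c, d)))) ∉ e := by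
    by_contra hcon
    push Not at hcon
    choose f hf g hg using hcon
    have hinj : Function.Injective f := by
      intro c c' hcc
      have h1 := hg c
      have h2 := hg c'
      rw [← hcc] at h2
      by_contra hne
      have hne' : (Sum.inr (Sum.inr (Sum.inr (c, g c))) : VV k n x M) ≠
          Sum.inr (Sum.inr (Sum.inr (c', g c'))) := by
        intro h; simp at h; exact hne h.1
      have h3 := (Sym2.mem_and_mem_iff hne').1 ⟨h1, h2⟩
      have h4 := hE (hf c)
      rw [h3, SimpleGraph.mem_edgeSet] at h4
      exact hne (same_copy k n x M _ _ _ _ h4)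
    have hr : Set.range f ⊆ EP := by rintro _ ⟨c, rfl⟩; exact hf c
    have h5 := Set.ncard_le_ncard hr (Set.toFinite _)
    rw [Set.ncard_range_of_injective hinj] at h5
    simp at h5
    omega
  obtain ⟨c, hc⟩ := hfree
  have hA : ((TG k n x M).deleteEdges EP).Adj (rootT k n x M)
      (Sum.inr (Sum.inr (Sum.inr (c, none)))) := by
    rw [SimpleGraph.deleteEdges_adj]
    exact ⟨adj_root k n x M c, fun h => hc _ h none (Sym2.mem_mk_right _ _)⟩
  have hL : ∀ d, lam (Sum.inr (Sum.inr (Sum.inr (c, d)))) = lam (rootT k n x M) := by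
    intro d
    symm
    apply hconst
    cases d with
    | none => exact hA.reachable
    | some d =>
      refine hA.reachable.trans (SimpleGraph.Adj.reachable ?_)
      rw [SimpleGraph.deleteEdges_adj]
      exact ⟨adj_leaf k n x M c d, fun h => hc _ h none (Sym2.mem_mk_left _ _)⟩
  have hbig : fixSize k n ≤ sizesMCC k n x M (lam (rootT k n x M)) := by
    rw [← hsz]
    let φ : Option (Fin (fixSize k n - 1)) → VV k n x M :=
      fun d => Sum.inr (Sum.inr (Sum.inr (c, d)))
    have hφ : Function.Injective φ := by intro a b h; simpa [φ] using h
    have hr : Set.range φ ⊆ {v | lam v = lam (rootT k n x M)} := by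
      rintro _ ⟨d, rfl⟩; exact hL d
    have h5 := Set.ncard_le_ncard hr (Set.toFinite _)
    rw [Set.ncard_range_of_injective hφ] at h5
    have : Nat.card (Option (Fin (fixSize k n - 1))) = fixSize k n - 1 + 1 := by simp
    omega
  rcases hl : lam (rootT k n x M) with j | pq | u
  · rw [hl] at hbig
    have := cc_le k n j.1 hk j.2
    simp only [sizesMCC, fixSize] at hbig
    omega
  · rw [hl] at hbig
    have := cjq_le k n pq.1.1.1 pq.1.2.1 hk pq.2 pq.1.2.2
    simp only [sizesMCC, fixSize] at hbig
    omega
  · rfl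
end
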